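/- arXiv:2107.12962 — 2 statements merged into one kernel-verified Lean document; each statement's English description precedes it below -/
import Mathlib

section
/- Let k be a field. The ring R = k[[y_1, y_2, y_3, t]]/(y_1 y_2 − y_3 t^r) is a normal complete local domain with trivial Picard group whose divisor class group is infinite cyclic, generated by the class of the prime divisor (y_1 = t = 0); moreover the class of (y_2 = t = 0) is the negative of this generator. -/
/-!
STATEMENT 6: Let `k` be a field and `r ≥ 1`.  The ring
`R = k[[y₁, y₂, y₃, t]]/(y₁y₂ − y₃tʳ)` is a normal complete local domain with trivial
Picard group whose (Weil) divisor class group is infinite cyclic, generated by the class of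
the prime divisor `(y₁ = t = 0)`; the class of `(y₂ = t = 0)` is its negative.

The Weil divisor class group of a commutative ring is defined from scratch as in the file
for STATEMENT 5.  "Trivial Picard group" is expressed (for the local domain `R`) as the
triviality of Mathlib's `ClassGroup R`, the group of invertible fractional ideals modulo
principal ones (for a local domain this is exactly the triviality of `Pic`),
and "complete" as adic completeness with respect to the maximal ideal.
-/

/-- `p` is a height-one prime: a nonzero prime minimal over `0`. -/
def IsHeightOnePrime (R : Type) [CommRing R] (p : Ideal R) : Prop :=
  p.IsPrime ∧ p ≠ ⊥ ∧ ∀ q : Ideal R, q.IsPrime → q < p → q = ⊥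

/-- Order of vanishing of `x` at the prime `p`, computed in the localization at `p`. -/
noncomputable def ordAt (R : Type) [CommRing R] (p : Ideal R) (hp : p.IsPrime) (x : R) :
    ℕ :=
  letI : p.IsPrime := hp
  sSup {n : ℕ | algebraMap R (Localization.AtPrime p) x ∈
    (IsLocalRing.maximalIdeal (Localization.AtPrime p)) ^ n}

/-- Weil divisors: finitely supported `ℤ`-linear combinations of height-one primes. -/
abbrev WeilDivisor (R : Type) [CommRing R] : Type :=
  {p : Ideal R // IsHeightOnePrime R p} →₀ ℤ

/-- The subgroup of principal Weil divisors `div(a/b)`. -/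
noncomputable def principalWeilDivisors (R : Type) [CommRing R] :
    AddSubgroup (WeilDivisor R) :=
  AddSubgroup.closure {D : WeilDivisor R | ∃ a b : R, a ≠ 0 ∧ b ≠ 0 ∧
    ∀ p : {p : Ideal R // IsHeightOnePrime R p},
      D p = (ordAt R p.1 p.2.1 a : ℤ) - (ordAt R p.1 p.2.1 b : ℤ)}

/-- The Weil divisor class group. -/
abbrev WeilClassGroup (R : Type) [CommRing R] : Type :=
  WeilDivisor R ⧸ principalWeilDivisors R

/-- The ring `k[[y₁,y₂,y₃,t]]/(y₁y₂ − y₃tʳ)`;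
variables: `X 0 = y₁`, `X 1 = y₂`, `X 2 = y₃`, `X 3 = t`. -/
abbrev ConeRing (k : Type) [Field k] (r : ℕ) : Type :=
  MvPowerSeries (Fin 4) k ⧸ Ideal.span
    {(MvPowerSeries.X 0 * MvPowerSeries.X 1 -
        MvPowerSeries.X 2 * MvPowerSeries.X 3 ^ r : MvPowerSeries (Fin 4) k)}

/-- The ideal `(y₁, t)` (the prime divisor `y₁ = t = 0`). -/
noncomputable def conePrime₁ (k : Type) [Field k] (r : ℕ) : Ideal (ConeRing k r) :=
  Ideal.span {Ideal.Quotient.mk _ (MvPowerSeries.X 0),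
    Ideal.Quotient.mk _ (MvPowerSeries.X 3)}

/-- The ideal `(y₂, t)` (the prime divisor `y₂ = t = 0`). -/
noncomputable def conePrime₂ (k : Type) [Field k] (r : ℕ) : Ideal (ConeRing k r) :=
  Ideal.span {Ideal.Quotient.mk _ (MvPowerSeries.X 1),
    Ideal.Quotient.mk _ (MvPowerSeries.X 3)}

section PowerSeriesFactorial

open Polynomial in
theorem Polynomial.IsDistinguishedAt.of_dvd {A : Type*} [CommRing A] [IsDomain A] {I : Ideal A}
    [I.IsPrime] {P Q : A[X]} (hP : P.IsDistinguishedAt I) (hQ : Q.Monic) (h : Q ∣ P) :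
    Q.IsDistinguishedAt I := by
  have hdvd : Q.map (Ideal.Quotient.mk I) ∣ X ^ P.natDegree := by
    rw [← hP.map_eq_X_pow]
    exact Polynomial.map_dvd _ h
  obtain ⟨j, -, hj⟩ := (dvd_prime_pow Polynomial.prime_X _).1 hdvd
  have hmap : Q.map (Ideal.Quotient.mk I) = X ^ j :=
    Polynomial.eq_of_monic_of_associated (hQ.map _) (monic_X_pow j) hj
  have hdeg : Q.natDegree = j := by
    rw [← hQ.natDegree_map (Ideal.Quotient.mk I), hmap, natDegree_X_pow]
  refine ⟨⟨fun {n} hn => ?_⟩, hQ⟩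
  have := congrArg (fun p => p.coeff n) hmap
  simp only [coeff_map, coeff_X_pow] at this
  rw [if_neg (by omega)] at this
  exact Ideal.Quotient.eq_zero_iff_mem.1 this

open Polynomial in
theorem Polynomial.IsDistinguishedAt.prime_coe {A : Type*} [CommRing A] [IsDomain A]
    {I : Ideal A} [I.IsPrime] [IsAdicComplete I A] {P Q : A[X]} (hP : P.IsDistinguishedAt I)
    (hQ : Prime Q) (h : Q ∣ P) : Prime (Q : PowerSeries A) := by
  have hu : IsUnit Q.leadingCoeff := by
    obtain ⟨T, rfl⟩ := h
    exact IsUnit.of_mul_eq_one _ (by simpa using hP.monic.leadingCoeff)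
  obtain ⟨v, hv⟩ := hu
  have hC : IsUnit (C (↑v⁻¹ : A)) := (Units.isUnit _).map C
  have hassoc : Associated Q (C (↑v⁻¹ : A) * Q) :=
    (associated_isUnit_mul_right_iff hC).2 (Associated.refl Q)
  have hmonic : (C (↑v⁻¹ : A) * Q).Monic := by
    rw [Monic, leadingCoeff_mul, leadingCoeff_C, ← hv, Units.inv_mul]
  have hprime : Prime (C (↑v⁻¹ : A) * Q) := hassoc.prime hQ
  have hdist := hP.of_dvd hmonic (hassoc.symm.dvd.trans h)
  have : (Ideal.span {C (↑v⁻¹ : A) * Q}).IsPrime :=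
    (Ideal.span_singleton_prime hprime.ne_zero).2 hprime
  have hdom : IsDomain (PowerSeries A ⧸ Ideal.span {((C (↑v⁻¹ : A) * Q : A[X]) : PowerSeries A)}) :=
    hdist.algEquivQuotient.symm.toMulEquiv.isDomain
  have hne : ((C (↑v⁻¹ : A) * Q : A[X]) : PowerSeries A) ≠ 0 := by
    rw [ne_eq, Polynomial.coe_eq_zero_iff]
    exact hprime.ne_zero
  have hp := (Ideal.span_singleton_prime hne).1 ((Ideal.Quotient.isDomain_iff_prime _).1 hdom)
  refine (Associated.prime ?_ hp)
  exact hassoc.symm.map (Polynomial.coeToPowerSeries.ringHom (R := A))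

theorem PowerSeries.exists_prime_mem_of_map_residue_ne_zero {A : Type*} [CommRing A] [IsDomain A]
    [IsLocalRing A] [IsAdicComplete (IsLocalRing.maximalIdeal A) A] [UniqueFactorizationMonoid A]
    {I : Ideal (PowerSeries A)} (hI : I.IsPrime) {g : PowerSeries A} (hgI : g ∈ I)
    (hg : g.map (IsLocalRing.residue A) ≠ 0) : ∃ x ∈ I, Prime x := by
  obtain ⟨P, u, hPu⟩ := g.exists_isWeierstrassFactorization hg
  have hPI : (P : PowerSeries A) ∈ I := by
    rw [hPu.eq_mul] at hgI
    exact (hI.mem_or_mem hgI).resolve_right fun h => hI.ne_top (I.eq_top_of_isUnit_mem h hPu.isUnit)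
  have key : I.comap (Polynomial.coeToPowerSeries.ringHom (R := A)) ≠ ⊥ := by
    intro hbot
    have : P ∈ I.comap (Polynomial.coeToPowerSeries.ringHom (R := A)) := hPI
    rw [hbot] at this
    exact hPu.isDistinguishedAt.monic.ne_zero this
  have hfac := UniqueFactorizationMonoid.exists_prime_factors P hPu.isDistinguishedAt.monic.ne_zero
  obtain ⟨s, hs, hsP⟩ := hfac
  have hmem : (Multiset.map (Polynomial.coeToPowerSeries.ringHom (R := A)) s).prod ∈ I := by
    rw [← map_multiset_prod]
    obtain ⟨v, hv⟩ := hsP.symm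
    rw [← hv, map_mul]
    exact I.mul_mem_right _ hPI
  obtain ⟨y, hy, hyI⟩ := (hI.multiset_prod_mem_iff_exists_mem _).1 hmem
  obtain ⟨q, hq, rfl⟩ := Multiset.mem_map.1 hy
  exact ⟨_, hyI, hPu.isDistinguishedAt.prime_coe (hs q hq)
    ((Multiset.dvd_prod hq).trans hsP.dvd)⟩

open MvPowerSeries in
theorem MvPowerSeries.maximalIdeal_eq_span_range_X {σ k : Type*} [Finite σ] [Field k] :
    IsLocalRing.maximalIdeal (MvPowerSeries σ k) = Ideal.span (Set.range X) := by
  classical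
  cases nonempty_fintype σ
  apply le_antisymm
  · have key : ∀ (T : Finset σ) (f : MvPowerSeries σ k),
        (∀ d, (∀ i ∈ T, d i = 0) → coeff d f = 0) → f ∈ Ideal.span (Set.range (X (R := k))) := by
      intro T
      induction T using Finset.induction_on with
      | empty =>
        intro f hf
        have : f = 0 := by ext d; simpa using hf d (by simp)
        simp [this]
      | insert i T _ ih =>
        intro f hf
        let f₁ : MvPowerSeries σ k := fun d => if d i = 0 then coeff d f else 0
        have h₁ : ∀ d, coeff d f₁ = if d i = 0 then coeff d f else 0 := fun d => rfl
        rw [← sub_add_cancel f f₁]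
        refine add_mem ?_ (ih f₁ fun d hd => ?_)
        · have : X i ∣ f - f₁ := X_dvd_iff.2 fun d hd => by simp [h₁, hd]
          exact Ideal.mem_of_dvd _ this (Ideal.subset_span ⟨i, rfl⟩)
        · rw [h₁]
          split_ifs with h
          · exact hf d (by simpa [h] using hd)
          · rfl
    intro f hf
    refine key Finset.univ f fun d hd => ?_
    have : d = 0 := by ext i; simpa using hd i
    rw [this, coeff_zero_eq_constantCoeff_apply]
    by_contra hne
    exact (IsLocalRing.mem_maximalIdeal _).1 hf (isUnit_iff_constantCoeff.2 (Ne.isUnit hne))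
  · rw [Ideal.span_le]
    rintro _ ⟨i, rfl⟩
    refine (IsLocalRing.mem_maximalIdeal _).2 fun h => ?_
    simpa using isUnit_iff_constantCoeff.1 h

instance MvPowerSeries.isAdicComplete_maximalIdeal {σ k : Type*} [Finite σ] [Field k] :
    IsAdicComplete (IsLocalRing.maximalIdeal (MvPowerSeries σ k)) (MvPowerSeries σ k) := by
  rw [MvPowerSeries.maximalIdeal_eq_span_range_X]
  infer_instance

end PowerSeriesFactorial

section ChangeOfVariables

namespace MvPowerSeries

variable {k : Type*} [Field k] {n : ℕ}

theorem exists_weights_unique_min {f : MvPowerSeries (Fin n) k} (hf : f ≠ 0) :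
    ∃ (D : ℕ) (m : Fin n →₀ ℕ), 0 < D ∧ coeff m f ≠ 0 ∧
      ∀ d ≠ m, coeff d f ≠ 0 → 
        ∑ i : Fin n, D ^ (i : ℕ) * m i < ∑ i : Fin n, D ^ (i : ℕ) * d i := by
  classical
  let g : MvPowerSeries (Fin n)ᵒᵈ k := f
  have hg : g ≠ 0 := hf
  obtain ⟨m, hm⟩ := exists_finsupp_eq_lexOrder_of_ne_zero hg
  let m' : Fin n →₀ ℕ := m
  refine ⟨1 + ∑ i, m' i, m', by omega, coeff_ne_zero_of_lexOrder (φ := g) hm.symm, fun d hd hdf => ?_⟩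
  set D := 1 + ∑ i, m' i with hD
  have hle : toLex m ≤ toLex (d : (Fin n)ᵒᵈ →₀ ℕ) := by
    have := lexOrder_le_of_coeff_ne_zero (φ := g) (d := d) hdf
    rw [hm] at this
    exact_mod_cast this
  have hlt : toLex m < toLex (d : (Fin n)ᵒᵈ →₀ ℕ) :=
    lt_of_le_of_ne hle fun h => hd (toLex.injective h).symm
  obtain ⟨i, hi', hmd'⟩ : ∃ i : Fin n, (∀ j, i < j → m' j = d j) ∧ m' i < d i := by
    obtain ⟨i, hi, hmd⟩ := hlt
    exact ⟨OrderDual.ofDual i, fun j hj => hi (OrderDual.toDual j) hj, hmd⟩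
  have hsplit : ∀ j : Fin n, D ^ (j : ℕ) * m' j + (if j = i then D ^ (j : ℕ) else 0) ≤
      D ^ (j : ℕ) * d j + (if j < i then D ^ (j : ℕ) * m' j else 0) := by
    intro j
    rcases lt_trichotomy j i with h | h | h
    · rw [if_neg h.ne, if_pos h]; omega
    · subst h
      rw [if_pos rfl, if_neg (lt_irrefl _), ← Nat.mul_succ]
      simpa using Nat.mul_le_mul_left _ hmd'
    · rw [if_neg h.ne', if_neg h.not_gt, hi' j h]
  have hsum := Finset.sum_le_sum fun j (_ : j ∈ Finset.univ) => hsplit j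
  rw [Finset.sum_add_distrib, Finset.sum_add_distrib] at hsum
  have h1 : (∑ j : Fin n, if j = i then D ^ (j : ℕ) else 0) = D ^ (i : ℕ) := by
    simp
  have h2 : (∑ j : Fin n, if j < i then D ^ (j : ℕ) * m' j else 0) <
      D ^ (i : ℕ) := by
    have h3 : D * (∑ j : Fin n, if j < i then D ^ (j : ℕ) * m' j else 0) ≤
        D ^ (i : ℕ) * ∑ j, m' j := by
      rw [Finset.mul_sum, Finset.mul_sum]
      refine Finset.sum_le_sum fun j _ => ?_
      split_ifs with h
      · rw [← mul_assoc, ← pow_succ']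
        exact Nat.mul_le_mul_right _ (Nat.pow_le_pow_right (by omega) h)
      · simp
    have h4 : D ^ (i : ℕ) * ∑ j, m' j < D ^ (i : ℕ) * D :=
      Nat.mul_lt_mul_of_pos_left (by omega) (Nat.pow_pos (by omega))
    rw [mul_comm] at h3
    exact Nat.lt_of_mul_lt_mul_right (h3.trans_lt h4)
  omega

theorem exists_algEquiv_regular {f : MvPowerSeries (Fin (n + 1)) k} (hf : f ≠ 0) :
    ∃ σ : MvPowerSeries (Fin (n + 1)) k ≃+* MvPowerSeries (Fin (n + 1)) k,
      (finSuccEquiv k n (σ f)).map (IsLocalRing.residue _) ≠ 0 := by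
  classical
  obtain ⟨D, m, hD, hm, hmin⟩ := exists_weights_unique_min hf
  let a : Fin (n + 1) → MvPowerSeries (Fin (n + 1)) k :=
    Fin.cases (X 0) fun i => X i.succ + X 0 ^ D ^ (i.succ : ℕ)
  let a' : Fin (n + 1) → MvPowerSeries (Fin (n + 1)) k :=
    Fin.cases (X 0) fun i => X i.succ - X 0 ^ D ^ (i.succ : ℕ)
  let b : Fin (n + 1) → MvPowerSeries Unit k := Fin.cases (X ()) fun _ => 0
  let c : Fin (n + 1) → MvPowerSeries Unit k := fun i => X () ^ D ^ (i : ℕ)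
  have ha : HasSubst a := hasSubst_of_constantCoeff_zero fun s => by
    cases s using Fin.cases <;> simp [a, hD.ne']
  have ha' : HasSubst a' := hasSubst_of_constantCoeff_zero fun s => by
    cases s using Fin.cases <;> simp [a', hD.ne']
  have hb : HasSubst b := hasSubst_of_constantCoeff_zero fun s => by
    cases s using Fin.cases <;> simp [b]
  have hc : HasSubst c := hasSubst_of_constantCoeff_zero fun s => by simp [c, hD.ne']
  have h1 : (fun s => subst a (a' s)) = X := by
    funext s
    cases s using Fin.cases with
    | zero => simp only [a', Fin.cases_zero, subst_X ha]; rfl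
    | succ i =>
      simp only [a', Fin.cases_succ, subst_sub ha, subst_pow ha, subst_X ha]
      simp [a]
  have h2 : (fun s => subst a' (a s)) = X := by
    funext s
    cases s using Fin.cases with
    | zero => simp only [a, Fin.cases_zero, subst_X ha']; rfl
    | succ i =>
      simp only [a, Fin.cases_succ, subst_add ha', subst_pow ha', subst_X ha']
      simp [a']
  have h3 : (fun s => subst b (a s)) = c := by
    funext s
    cases s using Fin.cases with
    | zero => simp [a, subst_X hb, b, c]
    | succ i =>
      simp only [a, Fin.cases_succ, subst_add hb, subst_pow hb, subst_X hb]
      simp [b, c]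
  let σ : MvPowerSeries (Fin (n + 1)) k ≃+* MvPowerSeries (Fin (n + 1)) k :=
    { (substAlgHom ha : _ →ₐ[k] _) with
      invFun := substAlgHom ha'
      left_inv := fun x => by
        change substAlgHom ha' (substAlgHom ha x) = x
        rw [substAlgHom_apply, substAlgHom_apply, subst_comp_subst_apply ha ha', h2, subst_self]
        rfl
      right_inv := fun x => by
        change substAlgHom ha (substAlgHom ha' x) = x
        rw [substAlgHom_apply, substAlgHom_apply, subst_comp_subst_apply ha' ha, h1, subst_self]
        rfl }
  have hσ : σ f = subst a f := substAlgHom_apply ha f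
  refine ⟨σ, fun h0 => ?_⟩
  rw [hσ] at h0
  have hzero : ∀ j, coeff (Finsupp.cons j 0) (subst a f) = 0 := by
    intro j
    have := congrArg (PowerSeries.coeff j) h0
    rw [PowerSeries.coeff_map, map_zero, IsLocalRing.residue_eq_zero_iff,
      IsLocalRing.mem_maximalIdeal, mem_nonunits_iff, isUnit_iff_constantCoeff,
      isUnit_iff_ne_zero, not_not, ← coeff_zero_eq_constantCoeff_apply,
      coeff_coeff_finSuccEquiv] at this
    exact this
  have hb0 : subst b (subst a f) = 0 := by
    refine MvPowerSeries.ext fun e => ?_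
    rw [coeff_subst hb, map_zero]
    refine finsum_eq_zero_of_forall_eq_zero fun d => ?_
    by_cases hd : ∃ i : Fin n, d i.succ ≠ 0
    · obtain ⟨i, hi⟩ := hd
      have : (d.prod fun s e => b s ^ e) = 0 :=
        Finset.prod_eq_zero (Finsupp.mem_support_iff.2 hi) (by simp [b, hi])
      simp [this]
    · push Not at hd
      have : d = Finsupp.cons (d 0) 0 := by
        ext i
        cases i using Fin.cases <;> simp [hd]
      rw [this, hzero, zero_smul]
  rw [subst_comp_subst_apply ha hb, h3] at hb0
  have hprod : ∀ d : Fin (n + 1) →₀ ℕ, (d.prod fun s e => c s ^ e) =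
      monomial (Finsupp.single () (∑ i : Fin (n + 1), D ^ (i : ℕ) * d i)) (1 : k) := by
    intro d
    rw [Finsupp.prod_fintype _ _ (by simp)]
    simp only [c, ← pow_mul]
    rw [Finset.prod_pow_eq_pow_sum, X_pow_eq]
  have := congrArg (coeff (Finsupp.single () (∑ i : Fin (n + 1), D ^ (i : ℕ) * m i))) hb0
  rw [coeff_subst hc, finsum_eq_single _ m, hprod, coeff_monomial_same, map_zero] at this
  · exact hm (by simpa using this)
  · intro d hd
    rw [hprod, coeff_monomial]
    by_cases hdf : coeff d f = 0
    · simp [hdf]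
    · have := hmin d hd hdf
      rw [if_neg, smul_zero]
      intro heq
      have := congrArg (fun t => t ()) heq
      simp at this
      omega

theorem uniqueFactorizationMonoid_fin (n : ℕ) :
    UniqueFactorizationMonoid (MvPowerSeries (Fin n) k) := by
  induction n with
  | zero =>
    exact (isEmptyEquiv (Fin 0) k).symm.toMulEquiv.uniqueFactorizationMonoid inferInstance
  | succ n ih =>
    have : IsDomain (MvPowerSeries (Fin n) k) := NoZeroDivisors.to_isDomain _
    have : IsDomain (MvPowerSeries (Fin (n + 1)) k) := NoZeroDivisors.to_isDomain _
    refine UniqueFactorizationMonoid.iff_exists_prime_mem_of_isPrime.2 fun I hI hprime => ?_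
    obtain ⟨f, hfI, hf⟩ := Submodule.exists_mem_ne_zero_of_ne_bot hI
    obtain ⟨σ, hσ⟩ := exists_algEquiv_regular hf
    let e := σ.trans (finSuccEquiv k n).toRingEquiv
    have hmem : ∀ x, x ∈ I.comap e.symm.toRingHom ↔ e.symm x ∈ I := fun x => Iff.rfl
    have hp : (I.comap e.symm.toRingHom).IsPrime := Ideal.comap_isPrime _ _
    obtain ⟨x, hx, hxp⟩ := PowerSeries.exists_prime_mem_of_map_residue_ne_zero hp
      (g := e f) ((hmem _).2 (by simpa using hfI)) hσ
    exact ⟨e.symm x, (hmem x).1 hx, (MulEquiv.prime_iff e.symm.toMulEquiv).2 hxp⟩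

end MvPowerSeries

end ChangeOfVariables

section Grading

/-- A notion of homogeneous element of integral weight in a commutative ring, with the
divisibility properties of the homogeneous elements of a graded factorial domain. -/
structure HomogeneousFamily (A : Type*) [CommRing A] where
  Homog : ℤ → A → Prop
  one : Homog 0 1
  mul : ∀ {v w x y}, Homog v x → Homog w y → Homog (v + w) (x * y)
  of_mul : ∀ {v w x y}, Homog w (x * y) → Homog v x → x ≠ 0 → Homog (w - v) y
  weight_unique : ∀ {v w x}, Homog v x → Homog w x → x ≠ 0 → v = w
  weight_of_isUnit : ∀ {w x}, Homog w x → IsUnit x → w = 0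
  exists_colon : ∀ {v w x y}, Homog v x → Homog w y → x ≠ 0 →
    ∃ h u, Homog u h ∧ h ≠ 0 ∧ ∀ z, x ∣ z * y ↔ h ∣ z

namespace MvPowerSeries

variable {σ k : Type*} [Field k] (wt : (σ →₀ ℕ) →+ ℤ)

/-- All monomials of `F` have weight `w`. -/
def IsWeightHomogeneous (w : ℤ) (F : MvPowerSeries σ k) : Prop :=
  ∀ d, coeff d F ≠ 0 → wt d = w

/-- The part of weight `w` of a power series. -/
noncomputable def weightComponent (w : ℤ) (F : MvPowerSeries σ k) : MvPowerSeries σ k :=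
  fun d => if wt d = w then coeff d F else 0

variable {wt} {v w : ℤ} {F G : MvPowerSeries σ k}

theorem coeff_weightComponent (w : ℤ) (F : MvPowerSeries σ k) (d : σ →₀ ℕ) :
    coeff d (weightComponent wt w F) = if wt d = w then coeff d F else 0 := rfl

theorem isWeightHomogeneous_weightComponent (w : ℤ) (F : MvPowerSeries σ k) :
    IsWeightHomogeneous wt w (weightComponent wt w F) := fun d hd => by
  rw [coeff_weightComponent] at hd
  by_contra h
  exact hd (if_neg h)

theorem IsWeightHomogeneous.coeff_eq_zero (hF : IsWeightHomogeneous wt w F) {d : σ →₀ ℕ}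
    (hd : wt d ≠ w) : coeff d F = 0 := by
  by_contra h
  exact hd (hF d h)

theorem IsWeightHomogeneous.mul (hF : IsWeightHomogeneous wt v F)
    (hG : IsWeightHomogeneous wt w G) : IsWeightHomogeneous wt (v + w) (F * G) := by
  classical
  intro d hd
  rw [coeff_mul] at hd
  obtain ⟨p, hp, hne⟩ := Finset.exists_ne_zero_of_sum_ne_zero hd
  rw [← Finset.HasAntidiagonal.mem_antidiagonal.1 hp, map_add, hF _ (left_ne_zero_of_mul hne),
    hG _ (right_ne_zero_of_mul hne)]

theorem IsWeightHomogeneous.weightComponent_mul (hF : IsWeightHomogeneous wt v F) (w : ℤ)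
    (G : MvPowerSeries σ k) :
    weightComponent wt w (F * G) = F * weightComponent wt (w - v) G := by
  classical
  refine MvPowerSeries.ext fun d => ?_
  rw [coeff_weightComponent, coeff_mul, coeff_mul]
  split_ifs with h
  · refine Finset.sum_congr rfl fun p hp => ?_
    rw [coeff_weightComponent]
    by_cases h0 : coeff p.1 F = 0
    · simp [h0]
    · rw [if_pos]
      rw [← h, ← Finset.HasAntidiagonal.mem_antidiagonal.1 hp, map_add, hF _ h0]
      ring
  · refine (Finset.sum_eq_zero fun p hp => ?_).symm
    rw [coeff_weightComponent]
    by_cases h0 : coeff p.1 F = 0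
    · simp [h0]
    · rw [if_neg, mul_zero]
      intro h2
      apply h
      rw [← Finset.HasAntidiagonal.mem_antidiagonal.1 hp, map_add, hF _ h0, h2]
      ring

theorem isWeightHomogeneous_of_weightComponent_eq_zero
    (h : ∀ u ≠ w, weightComponent wt u F = 0) : IsWeightHomogeneous wt w F := by
  intro d hd
  by_contra hne
  have := congrArg (coeff d) (h _ hne)
  rw [coeff_weightComponent, if_pos rfl, map_zero] at this
  exact hd this

theorem IsWeightHomogeneous.weightComponent_eq_zero (hF : IsWeightHomogeneous wt w F)
    (h : v ≠ w) : weightComponent wt v F = 0 := by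
  refine MvPowerSeries.ext fun d => ?_
  rw [coeff_weightComponent, map_zero]
  split_ifs with hd
  · exact hF.coeff_eq_zero (hd ▸ h)
  · rfl

theorem IsWeightHomogeneous.of_mul (hFG : IsWeightHomogeneous wt w (F * G))
    (hF : IsWeightHomogeneous wt v F) (h0 : F ≠ 0) : IsWeightHomogeneous wt (w - v) G := by
  refine isWeightHomogeneous_of_weightComponent_eq_zero fun u hu => ?_
  have h := hF.weightComponent_mul (u + v) G
  rw [hFG.weightComponent_eq_zero (by omega), add_sub_cancel_right] at h
  exact (mul_eq_zero.1 h.symm).resolve_left h0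

theorem exists_associated_isWeightHomogeneous (h0 : F ≠ 0)
    (hF : ∀ w, F ∣ weightComponent wt w F) :
    ∃ G w, IsWeightHomogeneous wt w G ∧ Associated F G := by
  obtain ⟨d, hd, hord⟩ := exists_coeff_ne_zero_and_order (ne_zero_iff_order_finite.1 h0)
  obtain ⟨u, hu⟩ := hF (wt d)
  have hcoeff : coeff d (weightComponent wt (wt d) F) ≠ 0 := by
    rwa [coeff_weightComponent, if_pos rfl]
  have hunit : IsUnit u := by
    have hle : F.order + u.order ≤ F.order := by
      rw [← order_mul, ← hu, ← hord]
      exact order_le hcoeff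
    have hu0 : u.order = 0 := by
      have hfin : F.order ≠ ⊤ := by rw [← hord]; exact ENat.natCast_ne_top _
      have : F.order + u.order ≤ F.order + 0 := by simpa using hle
      simpa using (ENat.add_le_add_iff_left hfin).1 this
    rw [isUnit_iff_constantCoeff, isUnit_iff_ne_zero]
    exact fun h => one_ne_zero (le_antisymm (hu0 ▸ one_le_order_iff_constCoeff_eq_zero.2 h)
      zero_le_one)
  exact ⟨_, _, isWeightHomogeneous_weightComponent (wt d) F, hunit.unit, hu.symm⟩

theorem IsWeightHomogeneous.exists_colon [UniqueFactorizationMonoid (MvPowerSeries σ k)]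
    (hF : IsWeightHomogeneous wt v F) (hG : IsWeightHomogeneous wt w G) (h0 : F ≠ 0) :
    ∃ h u, IsWeightHomogeneous wt u h ∧ h ≠ 0 ∧ ∀ z, F ∣ z * G ↔ h ∣ z := by
  obtain ⟨a, b, c, hrel, hca, hcb⟩ := UniqueFactorizationMonoid.exists_reduced_factors F h0 G
  have ha0 : a ≠ 0 := by rintro rfl; exact h0 (by rw [← hca, mul_zero])
  have hc0 : c ≠ 0 := by rintro rfl; exact h0 (by rw [← hca, zero_mul])
  have key : ∀ z, F ∣ z * G ↔ a ∣ z := by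
    intro z
    rw [← hca, ← hcb, mul_left_comm, mul_dvd_mul_iff_left hc0]
    exact ⟨hrel.dvd_of_dvd_mul_right, fun h => h.mul_right b⟩
  obtain ⟨h, u, hu, hassoc⟩ := exists_associated_isWeightHomogeneous (wt := wt) ha0 fun u => by
    rw [← key]
    obtain ⟨q, hq⟩ := (key a).2 dvd_rfl
    have h1 := hG.weightComponent_mul (u + w) a
    rw [mul_comm G a, hq, hF.weightComponent_mul, add_sub_cancel_right, mul_comm G] at h1
    exact ⟨_, h1.symm⟩
  exact ⟨h, u, hu, fun hh => ha0 (hassoc.eq_zero_iff.2 hh),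
    fun z => (key z).trans hassoc.dvd_iff_dvd_left⟩

variable (wt k) in
/-- Homogeneous power series with respect to a weight on monomials. -/
noncomputable def homogeneousFamily [UniqueFactorizationMonoid (MvPowerSeries σ k)] :
    HomogeneousFamily (MvPowerSeries σ k) where
  Homog := IsWeightHomogeneous wt
  one := fun d hd => by
    classical
    rw [coeff_one] at hd
    by_cases h : d = 0
    · rw [h, map_zero]
    · exact absurd (if_neg h) hd
  mul := IsWeightHomogeneous.mul
  of_mul := IsWeightHomogeneous.of_mul
  weight_unique := fun hv hw h0 => by
    obtain ⟨d, hd⟩ := (ne_zero_iff_exists_coeff_ne_zero _).1 h0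
    rw [← hv d hd, hw d hd]
  weight_of_isUnit := fun hw hx => by
    rw [isUnit_iff_constantCoeff, isUnit_iff_ne_zero] at hx
    rw [← hw 0 (by simpa using hx), map_zero]
  exists_colon := IsWeightHomogeneous.exists_colon

end MvPowerSeries

end Grading

section WeightZero

variable {R : Type} {A : Type*} [CommRing R] [CommRing A]

namespace HomogeneousFamily

variable {𝓗 : HomogeneousFamily A} {v w : ℤ} {x y : A}

theorem congr_weight (hx : 𝓗.Homog v x) (h : v = w) : 𝓗.Homog w x := h ▸ hx

theorem pow (hx : 𝓗.Homog v x) (n : ℕ) : 𝓗.Homog (n * v) (x ^ n) := by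
  induction n with
  | zero => simpa using 𝓗.one
  | succ n ih =>
    rw [pow_succ]
    exact 𝓗.congr_weight (𝓗.mul ih hx) (by push_cast; ring)

end HomogeneousFamily

/-- `φ` identifies `R` with the elements of weight zero of `A`, where `A` contains two
nonassociated primes `a` and `b` of weights `1` and `-1`. -/
structure IsWeightZeroSubring (𝓗 : HomogeneousFamily A) (φ : R →+* A) (a b : A) : Prop where
  injective : Function.Injective φ
  homog_zero_iff : ∀ z, 𝓗.Homog 0 z ↔ ∃ x, φ x = z
  prime_left : Prime a
  prime_right : Prime b
  homog_left : 𝓗.Homog 1 a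
  homog_right : 𝓗.Homog (-1) b
  not_dvd : ¬ a ∣ b
  exists_left : ∃ s, b ∣ φ s ∧ ¬ a ∣ φ s
  exists_right : ∃ s, a ∣ φ s ∧ ¬ b ∣ φ s

/-- `h` is a homogeneous element of weight `w` cutting out the prime `p` of the weight zero
subring, and `p` is principal after inverting some element outside `p`. -/
structure IsDivisorGenerator (𝓗 : HomogeneousFamily A) (φ : R →+* A) (p : Ideal R) (h : A)
    (w : ℤ) : Prop where
  homog : 𝓗.Homog w h
  ne_zero : h ≠ 0
  not_isUnit : ¬ IsUnit h
  dvd_or_dvd : ∀ {v₁ v₂ z₁ z₂}, 𝓗.Homog v₁ z₁ → 𝓗.Homog v₂ z₂ → h ∣ z₁ * z₂ → h ∣ z₁ ∨ h ∣ z₂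
  mem_iff : ∀ z, z ∈ p ↔ h ∣ φ z
  exists_cofactor : ∃ m s, 𝓗.Homog (-w) m ∧ ¬ h ∣ m ∧ m ∣ φ s ∧ ¬ h ∣ φ s

namespace IsDivisorGenerator

variable {𝓗 : HomogeneousFamily A} {φ : R →+* A} {a b h : A} {p : Ideal R} {w : ℤ}

theorem not_dvd_pow (G : IsDivisorGenerator 𝓗 φ p h w) {v : ℤ} {z : A} (hz : 𝓗.Homog v z)
    (hd : ¬ h ∣ z) (n : ℕ) : ¬ h ∣ z ^ n := by
  induction n with
  | zero => simpa [isUnit_iff_dvd_one] using G.not_isUnit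
  | succ n ih =>
    rw [pow_succ]
    exact fun hdvd => (G.dvd_or_dvd (𝓗.pow hz n) hz hdvd).elim ih hd

theorem isPrime (G : IsDivisorGenerator 𝓗 φ p h w) (H : IsWeightZeroSubring 𝓗 φ a b) :
    p.IsPrime where
  ne_top' := by
    rw [Ideal.ne_top_iff_one, G.mem_iff, map_one]
    simpa [isUnit_iff_dvd_one] using G.not_isUnit
  mem_or_mem' := fun {x y} hxy => by
    rw [G.mem_iff, map_mul] at hxy
    rw [G.mem_iff, G.mem_iff]
    exact G.dvd_or_dvd ((H.homog_zero_iff _).2 ⟨x, rfl⟩) ((H.homog_zero_iff _).2 ⟨y, rfl⟩) hxy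

variable [IsDomain A]

theorem exists_uniformizer (G : IsDivisorGenerator 𝓗 φ p h w)
    (H : IsWeightZeroSubring 𝓗 φ a b) :
    ∃ s π, s ∉ p ∧ π ∈ p ∧ π ≠ 0 ∧ (∀ z ∈ p, π ∣ s * z) ∧
      ∀ x n x', φ x = h ^ n * x' → ¬ h ∣ x' → ∃ u, u ∉ p ∧ s ^ n * x = π ^ n * u := by
  obtain ⟨m, s, hm, hhm, ⟨s', hs'⟩, hhs⟩ := G.exists_cofactor
  have hm0 : m ≠ 0 := by rintro rfl; exact hhm (dvd_zero h)
  have hR : ∀ x, 𝓗.Homog 0 (φ x) := fun x => (H.homog_zero_iff _).2 ⟨x, rfl⟩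
  have hsw : 𝓗.Homog w s' :=
    𝓗.congr_weight (𝓗.of_mul (hs' ▸ hR s) hm hm0) (by ring)
  have hhs' : ¬ h ∣ s' := fun hd => hhs (hs' ▸ hd.mul_left m)
  obtain ⟨π, hπ⟩ := (H.homog_zero_iff _).1 (𝓗.congr_weight (𝓗.mul G.homog hm) (by ring))
  refine ⟨s, π, fun hs => hhs ((G.mem_iff s).1 hs), (G.mem_iff π).2 (hπ ▸ dvd_mul_right h m),
    ?_, fun z hz => ?_, fun x n x' hx hx' => ?_⟩
  · rintro rfl
    rw [map_zero] at hπ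
    exact mul_ne_zero G.ne_zero hm0 hπ.symm
  · obtain ⟨z', hz'⟩ := (G.mem_iff z).1 hz
    have hzw : 𝓗.Homog (0 - w) z' := 𝓗.of_mul (hz' ▸ hR z) G.homog G.ne_zero
    obtain ⟨c, hc⟩ := (H.homog_zero_iff _).1 (𝓗.congr_weight (𝓗.mul hsw hzw) (by ring))
    refine ⟨c, H.injective ?_⟩
    rw [map_mul, map_mul, hs', hz', hπ, hc]
    ring
  · have hxw : 𝓗.Homog (0 - n * w) x' :=
      𝓗.of_mul (hx ▸ hR x) (𝓗.pow G.homog n) (pow_ne_zero n G.ne_zero)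
    obtain ⟨u, hu⟩ := (H.homog_zero_iff _).1
      (𝓗.congr_weight (𝓗.mul (𝓗.pow hsw n) hxw) (by ring))
    refine ⟨u, fun hup => ?_, H.injective ?_⟩
    · rw [G.mem_iff, hu] at hup
      exact (G.dvd_or_dvd (𝓗.pow hsw n) hxw hup).elim (G.not_dvd_pow hsw hhs' n) hx'
    · rw [map_mul, map_mul, map_pow, map_pow, hs', hx, hπ, hu]
      ring

theorem isHeightOnePrime [WfDvdMonoid A] (G : IsDivisorGenerator 𝓗 φ p h w)
    (H : IsWeightZeroSubring 𝓗 φ a b) : IsHeightOnePrime R p := by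
  have hp := G.isPrime H
  obtain ⟨s, π, hs, hπ, hπ0, hz, hx⟩ := G.exists_uniformizer H
  refine ⟨hp, fun h0 => hπ0 (by simpa [h0] using hπ), fun q hq hqp => ?_⟩
  by_contra hq0
  obtain ⟨x, hxq, hx0⟩ := Submodule.exists_mem_ne_zero_of_ne_bot hq0
  obtain ⟨n, x', hx', hn⟩ := WfDvdMonoid.max_power_factor'
    (fun h => hx0 (H.injective (h.trans (map_zero φ).symm))) G.not_isUnit
  obtain ⟨u, hu, hsu⟩ := hx x n x' hn hx'
  have hπq : π ∈ q := by
    have : π ^ n * u ∈ q := hsu ▸ q.mul_mem_left _ hxq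
    exact hq.mem_of_pow_mem n ((hq.mem_or_mem this).resolve_right fun h => hu (hqp.le h))
  refine hqp.not_ge fun z hzp => ?_
  obtain ⟨c, hc⟩ := hz z hzp
  exact (hq.mem_or_mem (hc ▸ q.mul_mem_right c hπq)).resolve_left fun h => hs (hqp.le h)

theorem ordAt_eq (G : IsDivisorGenerator 𝓗 φ p h w) (H : IsWeightZeroSubring 𝓗 φ a b)
    (hp : p.IsPrime) {x : R} {n : ℕ} {x' : A} (hx : φ x = h ^ n * x') (hx' : ¬ h ∣ x') :
    ordAt R p hp x = n := by
  have hR : ∀ x, 𝓗.Homog 0 (φ x) := fun x => (H.homog_zero_iff _).2 ⟨x, rfl⟩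
  have hset : {j : ℕ | algebraMap R (Localization.AtPrime p) x ∈
      (IsLocalRing.maximalIdeal (Localization.AtPrime p)) ^ j} = Set.Iic n := by
    ext j
    rw [Set.mem_ofPred_eq, Set.mem_Iic, ← Localization.AtPrime.map_eq_maximalIdeal,
      ← Ideal.map_pow, IsLocalization.algebraMap_mem_map_algebraMap_iff p.primeCompl]
    constructor
    · rintro ⟨s, hs, hsx⟩
      by_contra! hj
      have hle : p ^ j ≤ (Ideal.span {h ^ j}).comap φ := by
        rw [← Ideal.span_singleton_pow]
        refine le_trans (Ideal.pow_right_mono (fun z hz => ?_) j) (Ideal.le_comap_pow φ j)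
        exact Ideal.mem_span_singleton.2 ((G.mem_iff z).1 hz)
      have hdvd := Ideal.mem_span_singleton.1 (hle hsx)
      have hxw : 𝓗.Homog (0 - n * w) x' :=
        𝓗.of_mul (hx ▸ hR x) (𝓗.pow G.homog n) (pow_ne_zero n G.ne_zero)
      rw [map_mul, hx, mul_left_comm] at hdvd
      have h2 := (mul_dvd_mul_iff_left (pow_ne_zero n G.ne_zero)).1
        ((pow_succ h n ▸ pow_dvd_pow h hj : h ^ n * h ∣ h ^ j).trans hdvd)
      exact (G.dvd_or_dvd (hR s) hxw h2).elim (fun h => hs ((G.mem_iff s).2 h)) hx'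
    · intro hj
      obtain ⟨s, π, hs, hπ, -, -, hdec⟩ := G.exists_uniformizer H
      obtain ⟨u, hu, hsu⟩ := hdec x n x' hx hx'
      refine ⟨s ^ n, fun h => hs (hp.mem_of_pow_mem n h), ?_⟩
      rw [hsu]
      exact Ideal.mul_mem_right _ _ (Ideal.pow_le_pow_right hj (Ideal.pow_mem_pow hπ n))
  rw [ordAt, hset, csSup_Iic]

end IsDivisorGenerator

end WeightZero

section HeightOnePrimes

variable {R : Type} {A : Type*} [CommRing R] [CommRing A]

theorem IsHeightOnePrime.eq_of_le {p q : Ideal R} (hp : IsHeightOnePrime R p)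
    (hq : IsHeightOnePrime R q) (h : p ≤ q) : p = q :=
  h.eq_of_not_lt fun hlt => hp.2.1 (hq.2.2 p hp.1 hlt)

theorem IsHeightOnePrime.exists_mem_iff_dvd_mul [IsNoetherianRing R] {p : Ideal R}
    (hp : IsHeightOnePrime R p) : ∃ x y : R, x ≠ 0 ∧ ∀ z, z ∈ p ↔ x ∣ z * y := by
  obtain ⟨x, hxp, hx0⟩ := Submodule.exists_mem_ne_zero_of_ne_bot hp.2.1
  have hmin : p ∈ (Ideal.span {x}).minimalPrimes := by
    refine ⟨⟨hp.1, (Ideal.span_singleton_le_iff_mem _).2 hxp⟩, fun q hq hqp => ?_⟩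
    by_contra hpq
    have := hp.2.2 q hq.1 (lt_of_le_not_ge hqp hpq)
    exact hx0 (by simpa [this] using hq.2)
  have hass : p ∈ associatedPrimes R (R ⧸ Ideal.span {x}) := by
    apply Module.associatedPrimes.minimalPrimes_annihilator_subset_associatedPrimes
    rwa [Ideal.annihilator_quotient]
  obtain ⟨-, y', hy'⟩ := (isAssociatedPrime_iff (R := R)).1 hass
  obtain ⟨y, rfl⟩ := Ideal.Quotient.mk_surjective y'
  refine ⟨x, y, hx0, fun z => ?_⟩
  rw [hy', Submodule.mem_colon_singleton, Submodule.mem_bot, ← Ideal.mem_span_singleton,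
    ← Ideal.Quotient.eq_zero_iff_mem]
  rfl

theorem isHeightOnePrime_of_mem_minimalPrimes [IsDomain R] [IsNoetherianRing R] {x : R}
    (hx : x ≠ 0) {p : Ideal R} (hp : p ∈ (Ideal.span {x}).minimalPrimes) :
    IsHeightOnePrime R p := by
  have hprime := hp.1.1
  have hxp : x ∈ p := (Ideal.span_singleton_le_iff_mem _).1 hp.1.2
  refine ⟨hprime, fun h => hx (by simpa [h] using hxp), fun q hq hqp => ?_⟩
  by_contra hq0
  have h1 := Ideal.height_add_one_le_of_lt_of_isPrime hqp
  have h2 := Ideal.height_add_one_le_of_lt_of_isPrime (bot_lt_iff_ne_bot.2 hq0)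
  have h3 := Ideal.height_le_one_of_isPrincipal_of_mem_minimalPrimes _ _ hp
  have h4 : (1 : ℕ∞) + 1 ≤ 1 := by
    calc (1 : ℕ∞) + 1 ≤ ((⊥ : Ideal R).height + 1) + 1 := by gcongr; exact le_add_self
      _ ≤ q.height + 1 := by gcongr
      _ ≤ 1 := h1.trans h3
  exact absurd h4 (by decide)

namespace IsWeightZeroSubring

variable {𝓗 : HomogeneousFamily A} {φ : R →+* A} {a b : A}

theorem homog_map (H : IsWeightZeroSubring 𝓗 φ a b) (x : R) : 𝓗.Homog 0 (φ x) :=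
  (H.homog_zero_iff _).2 ⟨x, rfl⟩

theorem exists_homog_pow (H : IsWeightZeroSubring 𝓗 φ a b) (v : ℤ) :
    ∃ c n, (c = a ∨ c = b) ∧ 𝓗.Homog v (c ^ n) := by
  rcases le_total 0 v with hv | hv
  · exact ⟨a, v.toNat, Or.inl rfl, 𝓗.congr_weight (𝓗.pow H.homog_left _) (by omega)⟩
  · exact ⟨b, (-v).toNat, Or.inr rfl, 𝓗.congr_weight (𝓗.pow H.homog_right _) (by omega)⟩

theorem dvd_map_iff (H : IsWeightZeroSubring 𝓗 φ a b) {x y : R} (hx : x ≠ 0) :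
    φ x ∣ φ y ↔ x ∣ y := by
  refine ⟨fun ⟨q, hq⟩ => ?_, map_dvd φ⟩
  have hx0 : φ x ≠ 0 := fun h => hx (H.injective (h.trans (map_zero φ).symm))
  obtain ⟨c, rfl⟩ := (H.homog_zero_iff q).1
    (𝓗.congr_weight (𝓗.of_mul (hq ▸ H.homog_map y) (H.homog_map x) hx0) (sub_zero 0))
  exact ⟨c, H.injective (by rw [hq, map_mul])⟩

theorem isDivisorGenerator_left (H : IsWeightZeroSubring 𝓗 φ a b) :
    IsDivisorGenerator 𝓗 φ ((Ideal.span {a}).comap φ) a 1 where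
  homog := H.homog_left
  ne_zero := H.prime_left.ne_zero
  not_isUnit := H.prime_left.not_isUnit
  dvd_or_dvd := fun _ _ h => H.prime_left.dvd_or_dvd h
  mem_iff := fun _ => Ideal.mem_span_singleton
  exists_cofactor := by
    obtain ⟨s, hs, hs'⟩ := H.exists_left
    exact ⟨b, s, H.homog_right, H.not_dvd, hs, hs'⟩

variable [IsDomain A]

theorem not_dvd' (H : IsWeightZeroSubring 𝓗 φ a b) : ¬ b ∣ a := fun h =>
  H.not_dvd (H.prime_right.irreducible.dvd_symm H.prime_left.irreducible h)

theorem isDivisorGenerator_right (H : IsWeightZeroSubring 𝓗 φ a b) :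
    IsDivisorGenerator 𝓗 φ ((Ideal.span {b}).comap φ) b (-1) where
  homog := H.homog_right
  ne_zero := H.prime_right.ne_zero
  not_isUnit := H.prime_right.not_isUnit
  dvd_or_dvd := fun _ _ h => H.prime_right.dvd_or_dvd h
  mem_iff := fun _ => Ideal.mem_span_singleton
  exists_cofactor := by
    obtain ⟨s, hs, hs'⟩ := H.exists_right
    exact ⟨a, s, by simpa using H.homog_left, H.not_dvd', hs, hs'⟩

theorem comap_ne_comap (H : IsWeightZeroSubring 𝓗 φ a b) :
    (Ideal.span {a}).comap φ ≠ (Ideal.span {b}).comap φ := by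
  intro h
  obtain ⟨s, hs, hs'⟩ := H.exists_left
  exact hs' ((H.isDivisorGenerator_left.mem_iff s).1
    (h ▸ (H.isDivisorGenerator_right.mem_iff s).2 hs))

variable [UniqueFactorizationMonoid A]

theorem dvd_of_dvd_mul_pow (H : IsWeightZeroSubring 𝓗 φ a b) {h z c : A} (ha : ¬ a ∣ h)
    (hb : ¬ b ∣ h) (hc : c = a ∨ c = b) {n : ℕ} (hd : h ∣ z * c ^ n) : h ∣ z := by
  have hrel : IsRelPrime c h := by
    rcases hc with rfl | rfl
    · exact H.prime_left.irreducible.isRelPrime_iff_not_dvd.2 ha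
    · exact H.prime_right.irreducible.isRelPrime_iff_not_dvd.2 hb
  exact (hrel.pow_left (m := n)).symm.dvd_of_dvd_mul_right hd

theorem exists_isDivisorGenerator [IsNoetherianRing R] (H : IsWeightZeroSubring 𝓗 φ a b)
    {p : Ideal R} (hp : IsHeightOnePrime R p) (hpa : p ≠ (Ideal.span {a}).comap φ)
    (hpb : p ≠ (Ideal.span {b}).comap φ) :
    ∃ h w, IsDivisorGenerator 𝓗 φ p h w ∧ ¬ a ∣ h ∧ ¬ b ∣ h := by
  obtain ⟨x, y, hx0, hxy⟩ := hp.exists_mem_iff_dvd_mul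
  have hx0' : φ x ≠ 0 := fun h => hx0 (H.injective (h.trans (map_zero φ).symm))
  obtain ⟨h, w, hw, hh0, hh⟩ := 𝓗.exists_colon (H.homog_map x) (H.homog_map y) hx0'
  have hmem : ∀ z, z ∈ p ↔ h ∣ φ z := fun z => by
    rw [hxy, ← H.dvd_map_iff hx0, map_mul, hh]
  have hunit : ¬ IsUnit h := fun hu =>
    hp.1.ne_top ((Ideal.eq_top_iff_one p).2 ((hmem 1).2 hu.dvd))
  have ha : ¬ a ∣ h := fun hd => hpa <|
    hp.eq_of_le (H.isDivisorGenerator_left.isHeightOnePrime H) fun z hz =>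
      (H.isDivisorGenerator_left.mem_iff z).2 (hd.trans ((hmem z).1 hz))
  have hb : ¬ b ∣ h := fun hd => hpb <|
    hp.eq_of_le (H.isDivisorGenerator_right.isHeightOnePrime H) fun z hz =>
      (H.isDivisorGenerator_right.mem_iff z).2 (hd.trans ((hmem z).1 hz))
  refine ⟨h, w, ⟨hw, hh0, hunit, ?_, hmem, ?_⟩, ha, hb⟩
  · intro v₁ v₂ z₁ z₂ h₁ h₂ hd
    obtain ⟨c₁, n₁, hc₁, hw₁⟩ := H.exists_homog_pow (-v₁)
    obtain ⟨c₂, n₂, hc₂, hw₂⟩ := H.exists_homog_pow (-v₂)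
    obtain ⟨y₁, hy₁⟩ := (H.homog_zero_iff _).1
      (𝓗.congr_weight (𝓗.mul h₁ hw₁) (add_neg_cancel v₁))
    obtain ⟨y₂, hy₂⟩ := (H.homog_zero_iff _).1
      (𝓗.congr_weight (𝓗.mul h₂ hw₂) (add_neg_cancel v₂))
    have : y₁ * y₂ ∈ p := by
      rw [hmem, map_mul, hy₁, hy₂, mul_mul_mul_comm]
      exact hd.mul_right _
    refine (hp.1.mem_or_mem this).imp (fun h => ?_) (fun h => ?_)
    · rw [hmem, hy₁] at h
      exact H.dvd_of_dvd_mul_pow ha hb hc₁ h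
    · rw [hmem, hy₂] at h
      exact H.dvd_of_dvd_mul_pow ha hb hc₂ h
  · obtain ⟨c, n, hc, hcw⟩ := H.exists_homog_pow (-w)
    obtain ⟨t, ht⟩ := (H.homog_zero_iff _).1
      (𝓗.congr_weight (𝓗.mul H.homog_left H.homog_right) (add_neg_cancel 1))
    have hnot : ∀ c, (c = a ∨ c = b) → ¬ h ∣ c ^ n := fun c hc hd =>
      hunit (isUnit_iff_dvd_one.2 (H.dvd_of_dvd_mul_pow ha hb hc (by rwa [one_mul])))
    refine ⟨c ^ n, t ^ n, hcw, hnot c hc, ?_, fun hd => ?_⟩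
    · rw [map_pow, ht]
      refine pow_dvd_pow_of_dvd ?_ n
      rcases hc with rfl | rfl
      exacts [dvd_mul_right _ _, dvd_mul_left _ _]
    · rw [map_pow, ht, mul_pow] at hd
      exact hnot a (Or.inl rfl) (H.dvd_of_dvd_mul_pow ha hb (Or.inr rfl) hd)

theorem exists_isDivisorGenerator_dvd [IsDomain R] [IsNoetherianRing R]
    (H : IsWeightZeroSubring 𝓗 φ a b)
    {g : {p : Ideal R // IsHeightOnePrime R p} → A} {w : {p : Ideal R // IsHeightOnePrime R p} → ℤ}
    (hg : ∀ p, IsDivisorGenerator 𝓗 φ p.1 (g p) (w p))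
    (hga : ∀ p, p.1 = (Ideal.span {a}).comap φ → g p = a)
    (hgb : ∀ p, p.1 = (Ideal.span {b}).comap φ → g p = b)
    (hgab : ∀ p, p.1 ≠ (Ideal.span {a}).comap φ → p.1 ≠ (Ideal.span {b}).comap φ →
      ¬ a ∣ g p ∧ ¬ b ∣ g p)
    {x : A} {v : ℤ} (hx : 𝓗.Homog v x) (hx0 : x ≠ 0) (hxu : ¬ IsUnit x) : ∃ p, g p ∣ x := by
  by_cases ha : a ∣ x
  · exact ⟨⟨_, H.isDivisorGenerator_left.isHeightOnePrime H⟩, by rwa [hga _ rfl]⟩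
  by_cases hb : b ∣ x
  · exact ⟨⟨_, H.isDivisorGenerator_right.isHeightOnePrime H⟩, by rwa [hgb _ rfl]⟩
  obtain ⟨c, n, hc, hcw⟩ := H.exists_homog_pow (-v)
  obtain ⟨y, hy⟩ := (H.homog_zero_iff _).1
    (𝓗.congr_weight (𝓗.mul hx hcw) (add_neg_cancel v))
  have hc0 : c ≠ 0 := by
    rcases hc with rfl | rfl
    exacts [H.prime_left.ne_zero, H.prime_right.ne_zero]
  have hy0 : y ≠ 0 := by
    rintro rfl
    exact mul_ne_zero hx0 (pow_ne_zero n hc0) (hy.symm.trans (map_zero φ))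
  obtain ⟨q, hq, hqx⟩ := WfDvdMonoid.exists_irreducible_factor hxu hx0
  have hqprime := hq.prime
  have hQ : (Ideal.span {q}).IsPrime := (Ideal.span_singleton_prime hqprime.ne_zero).2 hqprime
  have hyQ : Ideal.span {y} ≤ (Ideal.span {q}).comap φ := by
    rw [Ideal.span_singleton_le_iff_mem, Ideal.mem_comap, hy, Ideal.mem_span_singleton]
    exact hqx.mul_right _
  obtain ⟨p, hp, hpQ⟩ := Ideal.exists_minimalPrimes_le hyQ
  have hp1 := isHeightOnePrime_of_mem_minimalPrimes hy0 hp
  obtain ⟨t, ht⟩ := (H.homog_zero_iff _).1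
    (𝓗.congr_weight (𝓗.mul H.homog_left H.homog_right) (add_neg_cancel 1))
  have htp : t ∉ p := fun h => by
    have := Ideal.mem_span_singleton.1 (Ideal.mem_comap.1 (hpQ h))
    rw [ht] at this
    rcases hqprime.dvd_or_dvd this with h | h
    · exact ha ((hq.dvd_symm H.prime_left.irreducible h).trans hqx)
    · exact hb ((hq.dvd_symm H.prime_right.irreducible h).trans hqx)
  have hgp := hgab ⟨p, hp1⟩
    (fun h => htp (Eq.symm h ▸ (H.isDivisorGenerator_left.mem_iff t).2 (ht ▸ dvd_mul_right a b) : t ∈ (⟨p, hp1⟩ : {p : Ideal R // IsHeightOnePrime R p}).1))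
    (fun h => htp (Eq.symm h ▸ (H.isDivisorGenerator_right.mem_iff t).2 (ht ▸ dvd_mul_left b a) : t ∈ (⟨p, hp1⟩ : {p : Ideal R // IsHeightOnePrime R p}).1))
  refine ⟨⟨p, hp1⟩, H.dvd_of_dvd_mul_pow hgp.1 hgp.2 hc (n := n) ?_⟩
  rw [← hy]
  exact ((hg ⟨p, hp1⟩).mem_iff y).1 (hp.1.2 (Ideal.mem_span_singleton_self y))

end IsWeightZeroSubring

end HeightOnePrimes

section ClassGroupComputation

variable {R : Type} {A : Type*} [CommRing R] [CommRing A]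

theorem HomogeneousFamily.prod {𝓗 : HomogeneousFamily A} {ι : Type*} {g : ι → A} {w : ι → ℤ}
    (hg : ∀ i, 𝓗.Homog (w i) (g i)) (s : Finset ι) (E : ι → ℕ) :
    𝓗.Homog (∑ i ∈ s, E i * w i) (∏ i ∈ s, g i ^ E i) := by
  classical
  induction s using Finset.induction_on with
  | empty => simpa using 𝓗.one
  | insert i s hi ih =>
    rw [Finset.sum_insert hi, Finset.prod_insert hi]
    exact 𝓗.mul (𝓗.pow (hg i) _) ih

/-- Homogeneous generators of all height-one primes, normalised at the two divisors cut out by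
`a` and `b`. -/
structure IsDivisorGeneratorFamily (𝓗 : HomogeneousFamily A) (φ : R →+* A) (a b : A)
    (g : {p : Ideal R // IsHeightOnePrime R p} → A)
    (w : {p : Ideal R // IsHeightOnePrime R p} → ℤ) : Prop where
  isDivisorGenerator : ∀ p, IsDivisorGenerator 𝓗 φ p.1 (g p) (w p)
  left : ∀ p, p.1 = (Ideal.span {a}).comap φ → g p = a ∧ w p = 1
  right : ∀ p, p.1 = (Ideal.span {b}).comap φ → g p = b ∧ w p = -1
  not_dvd : ∀ p, p.1 ≠ (Ideal.span {a}).comap φ → p.1 ≠ (Ideal.span {b}).comap φ →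
      ¬ a ∣ g p ∧ ¬ b ∣ g p

variable {𝓗 : HomogeneousFamily A} {φ : R →+* A} {a b : A}

theorem IsWeightZeroSubring.exists_family [IsDomain A] [UniqueFactorizationMonoid A]
    [IsNoetherianRing R] (H : IsWeightZeroSubring 𝓗 φ a b) :
    ∃ g w, IsDivisorGeneratorFamily 𝓗 φ a b g w := by
  have key : ∀ p : {p : Ideal R // IsHeightOnePrime R p}, ∃ h w,
      IsDivisorGenerator 𝓗 φ p.1 h w ∧
      (p.1 = (Ideal.span {a}).comap φ → h = a ∧ w = 1) ∧
      (p.1 = (Ideal.span {b}).comap φ → h = b ∧ w = -1) ∧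
      (p.1 ≠ (Ideal.span {a}).comap φ → p.1 ≠ (Ideal.span {b}).comap φ →
        ¬ a ∣ h ∧ ¬ b ∣ h) := by
    intro p
    by_cases hpa : p.1 = (Ideal.span {a}).comap φ
    · exact ⟨a, 1, hpa ▸ H.isDivisorGenerator_left, fun _ => ⟨rfl, rfl⟩,
        fun h => absurd (hpa.symm.trans h) H.comap_ne_comap, fun h => absurd hpa h⟩
    by_cases hpb : p.1 = (Ideal.span {b}).comap φ
    · exact ⟨b, -1, hpb ▸ H.isDivisorGenerator_right, fun h => absurd h hpa,
        fun _ => ⟨rfl, rfl⟩, fun _ h => absurd hpb h⟩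
    obtain ⟨h, w, hw, hab⟩ := H.exists_isDivisorGenerator p.2 hpa hpb
    exact ⟨h, w, hw, fun h => absurd h hpa, fun h => absurd h hpb, fun _ _ => hab⟩
  choose g w h₁ h₂ h₃ h₄ using key
  exact ⟨g, w, h₁, h₂, h₃, h₄⟩

namespace IsDivisorGeneratorFamily

variable {g : {p : Ideal R // IsHeightOnePrime R p} → A}
  {w : {p : Ideal R // IsHeightOnePrime R p} → ℤ}

theorem exists_eq_prod [IsDomain A] [UniqueFactorizationMonoid A] [IsDomain R]
    [IsNoetherianRing R] (F : IsDivisorGeneratorFamily 𝓗 φ a b g w)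
    (H : IsWeightZeroSubring 𝓗 φ a b) (x : A) :
    ∀ v, 𝓗.Homog v x → x ≠ 0 → ∃ (E : {p : Ideal R // IsHeightOnePrime R p} →₀ ℕ) (u : A),
      IsUnit u ∧ x = u * E.prod fun p n => g p ^ n := by
  classical
  refine wellFounded_dvdNotUnit.induction (C := fun x : A => ∀ v, 𝓗.Homog v x → x ≠ 0 →
    ∃ (E : {p : Ideal R // IsHeightOnePrime R p} →₀ ℕ) (u : A),
      IsUnit u ∧ x = u * E.prod fun p n => g p ^ n) x fun x ih v hx hx0 => ?_
  by_cases hxu : IsUnit x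
  · exact ⟨0, x, hxu, by simp⟩
  obtain ⟨p, y, rfl⟩ := H.exists_isDivisorGenerator_dvd F.isDivisorGenerator
    (fun p hp => (F.left p hp).1) (fun p hp => (F.right p hp).1) F.not_dvd hx hx0 hxu
  have G := F.isDivisorGenerator p
  have hy0 : y ≠ 0 := right_ne_zero_of_mul hx0
  obtain ⟨E, u, hu, hE⟩ := ih y ⟨hy0, g p, G.not_isUnit, mul_comm _ _⟩ _
    (𝓗.of_mul hx G.homog G.ne_zero) hy0
  refine ⟨E + Finsupp.single p 1, u, hu, ?_⟩
  rw [Finsupp.prod_add_index' (by simp) (by simp [pow_add]), Finsupp.prod_single_index (by simp),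
    pow_one, ← mul_assoc, ← hE, mul_comm]

theorem not_dvd_generator [IsDomain A] (F : IsDivisorGeneratorFamily 𝓗 φ a b g w)
    {p q : {p : Ideal R // IsHeightOnePrime R p}} (hpq : p ≠ q) : ¬ g p ∣ g q := fun h =>
  hpq <| Subtype.ext <| Eq.symm <| q.2.eq_of_le p.2 fun z hz =>
    ((F.isDivisorGenerator p).mem_iff z).2 (h.trans (((F.isDivisorGenerator q).mem_iff z).1 hz))

theorem ordAt_eq [IsDomain A] (F : IsDivisorGeneratorFamily 𝓗 φ a b g w)
    (H : IsWeightZeroSubring 𝓗 φ a b) {x : R} {u : A} (hu : IsUnit u)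
    {E : {p : Ideal R // IsHeightOnePrime R p} →₀ ℕ}
    (hx : φ x = u * E.prod fun p n => g p ^ n) (p : {p : Ideal R // IsHeightOnePrime R p}) :
    ordAt R p.1 p.2.1 x = E p := by
  classical
  have G := F.isDivisorGenerator p
  refine G.ordAt_eq H p.2.1
    (x' := u * ∏ q ∈ E.support.erase p, g q ^ E q) ?_ ?_
  · rw [hx, Finsupp.prod, mul_left_comm]
    congr 1
    by_cases hp : p ∈ E.support
    · exact (Finset.mul_prod_erase _ (fun q => g q ^ E q) hp).symm
    · rw [Finset.erase_eq_of_notMem hp, Finsupp.notMem_support_iff.1 hp, pow_zero, one_mul]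
  · have hprod : ∀ s : Finset {p : Ideal R // IsHeightOnePrime R p}, p ∉ s →
        ¬ g p ∣ ∏ q ∈ s, g q ^ E q := by
      intro s
      induction s using Finset.induction_on with
      | empty => simpa [isUnit_iff_dvd_one] using G.not_isUnit
      | insert q s hq ih =>
        intro hp hd
        rw [Finset.prod_insert hq] at hd
        rw [Finset.mem_insert, not_or] at hp
        have Gq := (F.isDivisorGenerator q).homog
        rcases G.dvd_or_dvd (𝓗.pow Gq _)
          (𝓗.prod (fun i => (F.isDivisorGenerator i).homog) s E) hd with h | h
        · exact G.not_dvd_pow Gq (F.not_dvd_generator hp.1) _ h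
        · exact ih hp.2 h
    rw [hu.dvd_mul_left]
    exact hprod _ (Finset.notMem_erase _ _)

end IsDivisorGeneratorFamily

theorem IsWeightZeroSubring.exists_weilClassGroup_equiv [IsDomain A]
    [UniqueFactorizationMonoid A] [IsDomain R] [IsNoetherianRing R]
    (H : IsWeightZeroSubring 𝓗 φ a b) :
    ∃ (h₁ : IsHeightOnePrime R ((Ideal.span {a}).comap φ))
      (h₂ : IsHeightOnePrime R ((Ideal.span {b}).comap φ)) (e : WeilClassGroup R ≃+ ℤ),
      e (QuotientAddGroup.mk (Finsupp.single ⟨_, h₁⟩ 1)) = 1 ∧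
      e (QuotientAddGroup.mk (Finsupp.single ⟨_, h₂⟩ 1)) = -1 := by
  classical
  obtain ⟨g, w, F⟩ := H.exists_family
  have h₁ := H.isDivisorGenerator_left.isHeightOnePrime H
  have h₂ := H.isDivisorGenerator_right.isHeightOnePrime H
  let Φ : WeilDivisor R →+ ℤ := (Finsupp.linearCombination ℤ w).toAddMonoidHom
  have hΦ : ∀ p n, Φ (Finsupp.single p n) = n * w p := fun p n =>
    Finsupp.linearCombination_single ℤ n p
  let ι : ({p : Ideal R // IsHeightOnePrime R p} →₀ ℕ) →+ WeilDivisor R :=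
    Finsupp.mapRange.addMonoidHom (Nat.castAddMonoidHom ℤ)
  have hι : ∀ E p, ι E p = (E p : ℤ) := fun E p => rfl
  have hΦι : ∀ E, Φ (ι E) = ∑ p ∈ E.support, E p * w p := by
    intro E
    change Finsupp.linearCombination ℤ w (Finsupp.mapRange (Nat.castAddMonoidHom ℤ) (map_zero _) E) = _
    rw [Finsupp.linearCombination_apply, Finsupp.sum_mapRange_index (by simp)]
    rfl
  have hhomog : ∀ E : {p : Ideal R // IsHeightOnePrime R p} →₀ ℕ,
      𝓗.Homog (Φ (ι E)) (E.prod fun p n => g p ^ n) := fun E => by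
    rw [hΦι]
    exact 𝓗.prod (fun i => (F.isDivisorGenerator i).homog) E.support E
  have hne : ∀ E : {p : Ideal R // IsHeightOnePrime R p} →₀ ℕ,
      (E.prod fun p n => g p ^ n) ≠ 0 := fun E =>
    Finset.prod_ne_zero_iff.2 fun p _ => pow_ne_zero _ (F.isDivisorGenerator p).ne_zero
  have hdiv : ∀ x : R, x ≠ 0 → ∃ E, (∀ p, ordAt R p.1 p.2.1 x = E p) ∧ Φ (ι E) = 0 := by
    intro x hx
    obtain ⟨E, u, hu, hxu⟩ := F.exists_eq_prod H (φ x) 0 (H.homog_map x)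
      fun h => hx (H.injective (h.trans (map_zero φ).symm))
    have huw : 𝓗.Homog (0 - Φ (ι E)) u := by
      refine 𝓗.of_mul (x := E.prod fun p n => g p ^ n) ?_ (hhomog E) (hne E)
      rw [mul_comm, ← hxu]
      exact H.homog_map x
    exact ⟨E, F.ordAt_eq H hu hxu, by have := 𝓗.weight_of_isUnit huw hu; omega⟩
  have hexists : ∀ E, Φ (ι E) = 0 → ∃ x : R, x ≠ 0 ∧ ∀ p, ordAt R p.1 p.2.1 x = E p := by
    intro E hE
    obtain ⟨x, hx⟩ := (H.homog_zero_iff _).1 (hE ▸ hhomog E)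
    refine ⟨x, ?_, F.ordAt_eq H isUnit_one (by rw [hx, one_mul])⟩
    rintro rfl
    exact hne E (hx.symm.trans (map_zero φ))
  have hker : principalWeilDivisors R = Φ.ker := by
    apply le_antisymm
    · refine (AddSubgroup.closure_le _).2 ?_
      rintro D ⟨x, y, hx, hy, hD⟩
      obtain ⟨E, hE, hE0⟩ := hdiv x hx
      obtain ⟨E', hE', hE0'⟩ := hdiv y hy
      have : D = ι E - ι E' := by
        ext p
        rw [hD, Finsupp.sub_apply, hι, hι, hE, hE']
      simp [AddMonoidHom.mem_ker, this, hE0, hE0']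
    · intro D hD
      rw [AddMonoidHom.mem_ker] at hD
      let P : {p : Ideal R // IsHeightOnePrime R p} →₀ ℕ := D.mapRange Int.toNat rfl
      let N : {p : Ideal R // IsHeightOnePrime R p} →₀ ℕ := (-D).mapRange Int.toNat rfl
      have hPN : ι P = D + ι N := by
        ext p
        rw [Finsupp.add_apply, hι, hι]
        change ((D p).toNat : ℤ) = D p + ((-D p).toNat : ℤ)
        omega
      obtain ⟨M, hM⟩ : ∃ M, Φ (ι M) = -Φ (ι N) := by
        have hs : ∀ p n, Φ (ι (Finsupp.single p n)) = n * w p := fun p n => by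
          rw [← hΦ]
          exact congrArg Φ (Finsupp.mapRange_single (hf := by simp))
        rcases le_total 0 (Φ (ι N)) with h | h
        · refine ⟨Finsupp.single ⟨_, h₂⟩ (Φ (ι N)).toNat, ?_⟩
          rw [hs, (F.right _ rfl).2]
          omega
        · refine ⟨Finsupp.single ⟨_, h₁⟩ (-Φ (ι N)).toNat, ?_⟩
          rw [hs, (F.left _ rfl).2]
          omega
      obtain ⟨x, hx, hxo⟩ := hexists (P + M) (by rw [map_add, map_add, hPN, map_add, hD, hM]; ring)
      obtain ⟨y, hy, hyo⟩ := hexists (N + M) (by rw [map_add, map_add, hM]; ring)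
      refine AddSubgroup.subset_closure ⟨x, y, hx, hy, fun p => ?_⟩
      have := DFunLike.congr_fun hPN p
      rw [Finsupp.add_apply, hι, hι] at this
      rw [hxo, hyo, Finsupp.add_apply, Finsupp.add_apply]
      push_cast
      omega
  have hsurj : Function.Surjective Φ := fun n =>
    ⟨Finsupp.single ⟨_, h₁⟩ n, by rw [hΦ, (F.left _ rfl).2, mul_one]⟩
  refine ⟨h₁, h₂, (QuotientAddGroup.quotientAddEquivOfEq hker).trans
    (QuotientAddGroup.quotientKerEquivOfSurjective Φ hsurj), ?_, ?_⟩
  · change Φ (Finsupp.single ⟨_, h₁⟩ 1) = 1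
    rw [hΦ, (F.left _ rfl).2, mul_one]
  · change Φ (Finsupp.single ⟨_, h₂⟩ 1) = -1
    rw [hΦ, (F.right _ rfl).2, one_mul]

theorem IsWeightZeroSubring.isIntegrallyClosed [IsDomain A] [IsIntegrallyClosed A] [IsDomain R]
    (H : IsWeightZeroSubring 𝓗 φ a b) : IsIntegrallyClosed R := by
  let ψ : FractionRing R →+* FractionRing A :=
    IsFractionRing.map H.injective
  have hψ : ∀ x, ψ (algebraMap R _ x) = algebraMap A _ (φ x) := fun x =>
    IsLocalization.map_eq _ x
  refine (isIntegrallyClosed_iff (FractionRing R)).2 fun {x} hx => ?_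
  have hint : IsIntegral A (ψ x) := by
    obtain ⟨P, hP, hP0⟩ := hx
    refine ⟨P.map φ, hP.map φ, ?_⟩
    rw [Polynomial.eval₂_map, show (algebraMap A (FractionRing A)).comp φ =
      ψ.comp (algebraMap R (FractionRing R)) from RingHom.ext fun x => (hψ x).symm,
      ← Polynomial.hom_eval₂, hP0, map_zero]
  obtain ⟨y, hy⟩ := (isIntegrallyClosed_iff (FractionRing A)).1 ‹_› hint
  obtain ⟨p, q, hq, rfl⟩ := IsFractionRing.div_surjective (A := R) x
  have hq0 : q ≠ 0 := nonZeroDivisors.ne_zero hq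
  have hφq : φ q ≠ 0 := fun h => hq0 (H.injective (h.trans (map_zero φ).symm))
  have hpq : φ p = φ q * y := by
    apply IsFractionRing.injective A (FractionRing A)
    rw [map_div₀, hψ, hψ, eq_div_iff] at hy
    · rw [← hy, map_mul, mul_comm]
    · exact (map_ne_zero_iff _ (IsFractionRing.injective A (FractionRing A))).2 hφq
  obtain ⟨c, hc⟩ := (H.dvd_map_iff hq0).1 ⟨y, hpq⟩
  refine ⟨c, ?_⟩
  rw [eq_div_iff ((map_ne_zero_iff _ (IsFractionRing.injective R (FractionRing R))).2 hq0),
    ← map_mul, hc, mul_comm]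

end ClassGroupComputation

section AdicCompleteness

theorem IsPrecomplete.of_surjective_linearMap {R M N : Type*} [CommRing R] [AddCommGroup M]
    [Module R M] [AddCommGroup N] [Module R N] (I : Ideal R) [IsPrecomplete I M] {f : M →ₗ[R] N}
    (hf : Function.Surjective f) : IsPrecomplete I N := by
  refine AdicCompletion.of_surjective_iff.1 fun y => ?_
  obtain ⟨x, rfl⟩ := AdicCompletion.map_surjective I hf y
  obtain ⟨m, rfl⟩ := AdicCompletion.of_surjective I M x
  exact ⟨f m, (AdicCompletion.map_of I f m).symm⟩

theorem IsLocalRing.isAdicComplete_of_surjective {R S : Type*} [CommRing R] [IsLocalRing R]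
    [CommRing S] [IsLocalRing S] [IsNoetherianRing S]
    [IsAdicComplete (IsLocalRing.maximalIdeal R) R] (f : R →+* S) (hf : Function.Surjective f) :
    IsAdicComplete (IsLocalRing.maximalIdeal S) S := by
  algebraize [f]
  have h : (IsLocalRing.maximalIdeal R).map (algebraMap R S) = IsLocalRing.maximalIdeal S :=
    IsLocalRing.map_maximalIdeal_of_surjective f hf
  have : IsPrecomplete (IsLocalRing.maximalIdeal R) S :=
    IsPrecomplete.of_surjective_linearMap _ (f := Algebra.linearMap R S) hf
  have : IsPrecomplete (IsLocalRing.maximalIdeal S) S :=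
    h ▸ IsPrecomplete.map_algebraMap_iff.2 this
  exact {}

theorem ClassGroup.subsingleton_of_isLocalRing (R : Type*) [CommRing R] [IsDomain R]
    [IsLocalRing R] : Subsingleton (ClassGroup R) :=
  (ClassGroup.equivPic R).toEquiv.subsingleton

end AdicCompleteness

section Cone

open MvPowerSeries

namespace MvPowerSeries

variable {σ k : Type*} [Field k]

theorem irreducible_X (i : σ) : Irreducible (X i : MvPowerSeries σ k) := by
  constructor
  · rw [isUnit_iff_constantCoeff, constantCoeff_X]
    exact not_isUnit_zero
  · intro f g hfg
    by_contra! h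
    rw [isUnit_iff_constantCoeff, isUnit_iff_ne_zero, not_not, isUnit_iff_constantCoeff,
      isUnit_iff_ne_zero, not_not, ← one_le_order_iff_constCoeff_eq_zero,
      ← one_le_order_iff_constCoeff_eq_zero] at h
    have h2 : (X i : MvPowerSeries σ k).order ≤ 1 := by
      refine (order_le (d := Finsupp.single i 1) ?_).trans (by simp)
      rw [coeff_index_single_self_X]
      exact one_ne_zero
    rw [hfg, order_mul] at h2
    exact absurd ((add_le_add h.1 h.2).trans h2) (by decide)

theorem X_dvd_X_iff {i j : σ} : (X i : MvPowerSeries σ k) ∣ X j ↔ i = j := by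
  classical
  refine ⟨fun h => ?_, fun h => h ▸ dvd_rfl⟩
  by_contra hij
  have := X_dvd_iff.1 h (Finsupp.single j 1) (by simp [Ne.symm hij])
  rw [coeff_index_single_self_X] at this
  exact one_ne_zero this

theorem mem_span_X_pair {i j : σ} {F : MvPowerSeries σ k}
    (hF : ∀ d : σ →₀ ℕ, d i = 0 → d j = 0 → coeff d F = 0) :
    F ∈ Ideal.span {X i, X j} := by
  let P : MvPowerSeries σ k := fun d => if d i = 0 then 0 else coeff d F
  have hP : ∀ d, coeff d P = if d i = 0 then 0 else coeff d F := fun _ => rfl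
  obtain ⟨u, hu⟩ : X i ∣ P := X_dvd_iff.2 fun d hd => by rw [hP, if_pos hd]
  obtain ⟨v, hv⟩ : X j ∣ F - P := X_dvd_iff.2 fun d hd => by
    rw [map_sub, hP]
    split_ifs with h
    · rw [hF d h hd, sub_zero]
    · rw [sub_self]
  exact Ideal.mem_span_pair.2 ⟨u, v, by rw [mul_comm u, mul_comm v, ← hu, ← hv]; ring⟩

end MvPowerSeries

namespace ConeRing

variable {k : Type} [Field k] {r : ℕ}

/-- The exponent of the monomial with the given four coordinates. -/
noncomputable def quad (x y z w : ℕ) : Fin 4 →₀ ℕ := Finsupp.equivFunOnFinite.symm ![x, y, z, w]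

@[simp] theorem quad_zero (x y z w : ℕ) : quad x y z w 0 = x := rfl
@[simp] theorem quad_one (x y z w : ℕ) : quad x y z w 1 = y := rfl
@[simp] theorem quad_two (x y z w : ℕ) : quad x y z w 2 = z := rfl
@[simp] theorem quad_three (x y z w : ℕ) : quad x y z w 3 = w := rfl

theorem exponent_ext {d e : Fin 4 →₀ ℕ} (h0 : d 0 = e 0) (h1 : d 1 = e 1) (h2 : d 2 = e 2)
    (h3 : d 3 = e 3) : d = e := by
  ext i
  fin_cases i <;> assumption

theorem eq_quad (d : Fin 4 →₀ ℕ) : d = quad (d 0) (d 1) (d 2) (d 3) :=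
  exponent_ext rfl rfl rfl rfl

variable (r) in
/-- Exponents of the four monomials parametrising the cone. -/
noncomputable def generatorExponent : Fin 4 → (Fin 4 →₀ ℕ) :=
  ![quad r 0 1 0, quad 0 r 0 1, quad 0 0 1 1, quad 1 1 0 0]

variable (r) in
/-- The action of the monomial parametrisation on exponents. -/
noncomputable def exponentMap (d : Fin 4 →₀ ℕ) : Fin 4 →₀ ℕ :=
  quad (r * d 0 + d 3) (r * d 1 + d 3) (d 0 + d 2) (d 1 + d 2)

variable (k r) in
/-- The four monomials parametrising the cone. -/
noncomputable def generator (i : Fin 4) : MvPowerSeries (Fin 4) k :=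
  monomial (generatorExponent r i) 1

theorem generator_zero : generator k r 0 = X 0 ^ r * X 2 := by
  rw [generator, X_pow_eq, X, monomial_mul_monomial, one_mul]
  congr 2
  exact exponent_ext (by simp [generatorExponent]) (by simp [generatorExponent])
    (by simp [generatorExponent]) (by simp [generatorExponent])

theorem generator_one : generator k r 1 = X 1 ^ r * X 3 := by
  rw [generator, X_pow_eq, X, monomial_mul_monomial, one_mul]
  congr 2
  exact exponent_ext (by simp [generatorExponent]) (by simp [generatorExponent])
    (by simp [generatorExponent]) (by simp [generatorExponent])

theorem generator_two : generator k r 2 = X 2 * X 3 := by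
  rw [generator, X, X, monomial_mul_monomial, one_mul]
  congr 2
  exact exponent_ext (by simp [generatorExponent]) (by simp [generatorExponent])
    (by simp [generatorExponent]) (by simp [generatorExponent])

theorem generator_three : generator k r 3 = X 0 * X 1 := by
  rw [generator, X, X, monomial_mul_monomial, one_mul]
  congr 2
  exact exponent_ext (by simp [generatorExponent]) (by simp [generatorExponent])
    (by simp [generatorExponent]) (by simp [generatorExponent])

theorem hasSubst_generator : HasSubst (generator k r) :=
  hasSubst_of_constantCoeff_zero fun i => by
    fin_cases i
    · change constantCoeff (generator k r 0) = 0
      simp [generator_zero]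
    · change constantCoeff (generator k r 1) = 0
      simp [generator_one]
    · change constantCoeff (generator k r 2) = 0
      simp [generator_two]
    · change constantCoeff (generator k r 3) = 0
      simp [generator_three]

variable (k r) in
/-- The monomial parametrisation of the cone. -/
noncomputable def param : MvPowerSeries (Fin 4) k →+* MvPowerSeries (Fin 4) k :=
  (substAlgHom (R := k) (hasSubst_generator (k := k) (r := r))).toRingHom

theorem param_X (i : Fin 4) : param k r (X i) = generator k r i := by
  change substAlgHom hasSubst_generator (X i) = _
  rw [substAlgHom_apply, subst_X hasSubst_generator]

theorem coeff_param (F : MvPowerSeries (Fin 4) k) (e : Fin 4 →₀ ℕ) :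
    coeff e (param k r F) = ∑ᶠ d, if exponentMap r d = e then coeff d F else 0 := by
  classical
  change coeff e (substAlgHom hasSubst_generator F) = _
  rw [substAlgHom_apply, coeff_subst hasSubst_generator]
  refine finsum_congr fun d => ?_
  have : (d.prod fun s e => generator k r s ^ e) = monomial (exponentMap r d) 1 := by
    rw [Finsupp.prod_fintype _ _ (by simp)]
    simp only [generator, monomial_pow, one_pow, Fin.prod_univ_four, monomial_mul_monomial, one_mul]
    congr 2
    refine exponent_ext ?_ ?_ ?_ ?_ <;> simp [generatorExponent, exponentMap, mul_comm]
  rw [this, coeff_monomial]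
  simp [eq_comm]

/-- Summation along the fibres of the monomial parametrisation. -/
theorem coeff_param_exponentMap (F : MvPowerSeries (Fin 4) k) {x y : ℕ} (hxy : x = 0 ∨ y = 0)
    (z w : ℕ) : coeff (exponentMap r (quad x y z w)) (param k r F) =
      ∑ i ∈ Finset.range (z + 1),
        if r * i ≤ w then coeff (quad (x + i) (y + i) (z - i) (w - r * i)) F else 0 := by
  classical
  rw [coeff_param, ← Finset.sum_filter]
  have hinj : Set.InjOn (fun i => quad (x + i) (y + i) (z - i) (w - r * i))
      ((Finset.range (z + 1)).filter fun i => r * i ≤ w) := fun i _ j _ hij => by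
    have := DFunLike.congr_fun hij 0
    simpa using this
  rw [finsum_eq_sum_of_support_subset (s := ((Finset.range (z + 1)).filter fun i => r * i ≤ w).image
    fun i => quad (x + i) (y + i) (z - i) (w - r * i)), Finset.sum_image hinj]
  · refine Finset.sum_congr rfl fun i hi => if_pos ?_
    rw [Finset.mem_filter, Finset.mem_range] at hi
    refine exponent_ext ?_ ?_ ?_ ?_ <;> simp [exponentMap, mul_add] <;> omega
  · intro d hd
    have hd' : exponentMap r d = exponentMap r (quad x y z w) := by
      by_contra h
      exact hd (if_neg h)
    have h0 := DFunLike.congr_fun hd' 0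
    have h1 := DFunLike.congr_fun hd' 1
    have h2 := DFunLike.congr_fun hd' 2
    have h3 := DFunLike.congr_fun hd' 3
    simp only [exponentMap, quad_zero, quad_one, quad_two, quad_three] at h0 h1 h2 h3
    obtain ⟨i, hi⟩ : ∃ i, d 0 = x + i := ⟨d 0 - x, by omega⟩
    rw [hi, mul_add] at h0
    rw [Finset.mem_coe, Finset.mem_image]
    refine ⟨i, ?_, exponent_ext ?_ ?_ ?_ ?_⟩
    · rw [Finset.mem_filter, Finset.mem_range]
      omega
    all_goals simp only [quad_zero, quad_one, quad_two, quad_three]; omega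

theorem coeff_X_zero_mul_X_one_mul (F : MvPowerSeries (Fin 4) k) (x y z w : ℕ) :
    coeff (quad x y z w) (X 0 * X 1 * F) =
      if 1 ≤ x ∧ 1 ≤ y then coeff (quad (x - 1) (y - 1) z w) F else 0 := by
  have : (X 0 * X 1 : MvPowerSeries (Fin 4) k) = monomial (quad 1 1 0 0) 1 := by
    rw [← generator_three (r := 0)]
    rfl
  rw [this, coeff_monomial_mul, one_mul]
  refine if_congr ?_ (congrArg (fun d => coeff d F) (exponent_ext ?_ ?_ ?_ ?_)) rfl
  · rw [Finsupp.le_def, Fin.forall_fin_succ, Fin.forall_fin_succ, Fin.forall_fin_succ]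
    simp [quad]
  all_goals simp

theorem coeff_X_two_mul_X_three_pow_mul (F : MvPowerSeries (Fin 4) k) (x y z w : ℕ) :
    coeff (quad x y z w) (X 2 * X 3 ^ r * F) =
      if 1 ≤ z ∧ r ≤ w then coeff (quad x y (z - 1) (w - r)) F else 0 := by
  have : (X 2 * X 3 ^ r : MvPowerSeries (Fin 4) k) = monomial (quad 0 0 1 r) 1 := by
    rw [X_pow_eq, X, monomial_mul_monomial, one_mul]
    congr 2
    exact exponent_ext (by simp) (by simp) (by simp) (by simp)
  rw [this, coeff_monomial_mul, one_mul]
  refine if_congr ?_ (congrArg (fun d => coeff d F) (exponent_ext ?_ ?_ ?_ ?_)) rfl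
  · rw [Finsupp.le_def, Fin.forall_fin_succ, Fin.forall_fin_succ, Fin.forall_fin_succ]
    simp [quad]
  all_goals simp

/-- The kernel of the parametrisation is generated by the equation of the cone. -/
theorem dvd_of_param_eq_zero {F : MvPowerSeries (Fin 4) k} (hF : param k r F = 0) :
    (X 0 * X 1 - X 2 * X 3 ^ r : MvPowerSeries (Fin 4) k) ∣ F := by
  let G : ℕ → ℕ → ℕ → ℕ → k := fun x y z w => ∑ i ∈ Finset.range (z + 1),
    if r * i ≤ w then coeff (quad (x + i) (y + i) (z - i) (w - r * i)) F else 0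
  let H : MvPowerSeries (Fin 4) k := fun d => G (d 0 + 1) (d 1 + 1) (d 2) (d 3)
  have hH : ∀ x y z w, coeff (quad x y z w) H = G (x + 1) (y + 1) z w := fun _ _ _ _ => rfl
  have hG0 : ∀ x y z w, (x = 0 ∨ y = 0) → G x y z w = 0 := fun x y z w hxy => by
    exact (coeff_param_exponentMap F hxy z w).symm.trans (by rw [hF, map_zero])
  have hG : ∀ x y z w, G x y z w = coeff (quad x y z w) F +
      if 1 ≤ z ∧ r ≤ w then G (x + 1) (y + 1) (z - 1) (w - r) else 0 := by
    intro x y z w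
    refine (Finset.sum_range_succ' _ z).trans ((add_comm _ _).trans (congrArg₂ (· + ·) ?_ ?_))
    · simp
    · split_ifs with h
      · obtain ⟨z, rfl⟩ : ∃ z', z = z' + 1 := ⟨z - 1, by omega⟩
        change _ = ∑ i ∈ Finset.range (z + 1), _
        refine Finset.sum_congr rfl fun i _ => ?_
        rw [mul_add, mul_one, ← add_assoc, ← add_assoc, add_right_comm x, add_right_comm y,
          Nat.add_sub_add_right, ← Nat.sub_sub, Nat.sub_right_comm]
        exact if_congr (by omega) rfl rfl
      · refine Finset.sum_eq_zero fun i hi => if_neg ?_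
        rw [Finset.mem_range] at hi
        rw [mul_add]
        omega
  refine ⟨H, MvPowerSeries.ext fun d => ?_⟩
  rw [eq_quad d, sub_mul, map_sub, coeff_X_zero_mul_X_one_mul, coeff_X_two_mul_X_three_pow_mul,
    hH, hH, eq_sub_iff_add_eq, ← hG]
  split_ifs with h
  · rw [Nat.sub_add_cancel h.1, Nat.sub_add_cancel h.2]
  · exact hG0 _ _ _ _ (by omega)

variable (r) in
/-- The weight on monomials whose weight zero part is the cone. -/
noncomputable def weight : (Fin 4 →₀ ℕ) →+ ℤ where
  toFun d := d 0 - d 1 - r * d 2 + r * d 3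
  map_zero' := by simp
  map_add' d e := by simp; ring

theorem weight_apply (d : Fin 4 →₀ ℕ) :
    weight r d = (d 0 : ℤ) - d 1 - r * d 2 + r * d 3 := rfl

theorem weight_exponentMap (d : Fin 4 →₀ ℕ) : weight r (exponentMap r d) = 0 := by
  simp [weight_apply, exponentMap]
  ring

theorem exists_exponentMap_eq {e : Fin 4 →₀ ℕ} (he : weight r e = 0) :
    ∃ x y z w, (x = 0 ∨ y = 0) ∧ exponentMap r (quad x y z w) = e := by
  rw [weight_apply] at he
  rcases le_total (e 3) (e 2) with h | h
  · obtain ⟨x, hx⟩ := Nat.exists_eq_add_of_le h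
    refine ⟨x, 0, e 3, e 1, Or.inr rfl, exponent_ext ?_ ?_ ?_ ?_⟩ <;> simp [exponentMap]
    · rw [hx] at he
      push_cast at he
      zify
      linarith
    · omega
  · obtain ⟨y, hy⟩ := Nat.exists_eq_add_of_le h
    refine ⟨0, y, e 2, e 0, Or.inl rfl, exponent_ext ?_ ?_ ?_ ?_⟩ <;> simp [exponentMap]
    · rw [hy] at he
      push_cast at he
      zify
      linarith
    · omega

theorem coeff_param_of_weight_ne_zero (F : MvPowerSeries (Fin 4) k) {e : Fin 4 →₀ ℕ}
    (he : weight r e ≠ 0) : coeff e (param k r F) = 0 := by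
  rw [coeff_param]
  refine finsum_eq_zero_of_forall_eq_zero fun d => if_neg ?_
  rintro rfl
  exact he (weight_exponentMap d)

theorem isWeightHomogeneous_zero_iff (z : MvPowerSeries (Fin 4) k) :
    IsWeightHomogeneous (weight r) 0 z ↔ ∃ F, param k r F = z := by
  constructor
  · intro hz
    let F : MvPowerSeries (Fin 4) k := fun d =>
      if d 0 = 0 ∨ d 1 = 0 then coeff (exponentMap r d) z else 0
    have hF : ∀ d, coeff d F = if d 0 = 0 ∨ d 1 = 0 then coeff (exponentMap r d) z else 0 :=
      fun _ => rfl
    refine ⟨F, MvPowerSeries.ext fun e => ?_⟩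
    by_cases he : weight r e = 0
    · obtain ⟨x, y, z, w, hxy, rfl⟩ := exists_exponentMap_eq he
      rw [coeff_param_exponentMap F hxy, Finset.sum_range_succ', Finset.sum_eq_zero]
      · simp [hF, hxy]
      · intro i _
        simp [hF]
    · rw [coeff_param_of_weight_ne_zero F he, hz.coeff_eq_zero he]
  · rintro ⟨F, rfl⟩ e he
    by_contra h
    exact he (coeff_param_of_weight_ne_zero F h)

variable (k r) in
/-- The embedding of the cone into a power series ring as its weight zero part. -/
noncomputable def embedding : ConeRing k r →+* MvPowerSeries (Fin 4) k :=
  Ideal.Quotient.lift _ (param k r) fun F hF => by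
    obtain ⟨G, rfl⟩ := Ideal.mem_span_singleton.1 hF
    simp only [map_mul, map_sub, map_pow, param_X, generator_zero, generator_one, generator_two,
      generator_three]
    ring

theorem embedding_mk (F : MvPowerSeries (Fin 4) k) :
    embedding k r (Ideal.Quotient.mk _ F) = param k r F := rfl

theorem embedding_injective : Function.Injective (embedding k r) := by
  refine (injective_iff_map_eq_zero _).2 fun z hz => ?_
  obtain ⟨F, rfl⟩ := Ideal.Quotient.mk_surjective z
  exact Ideal.Quotient.eq_zero_iff_mem.2 (Ideal.mem_span_singleton.2 (dvd_of_param_eq_zero hz))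

instance : UniqueFactorizationMonoid (MvPowerSeries (Fin 4) k) :=
  uniqueFactorizationMonoid_fin 4

theorem prime_X (i : Fin 4) : Prime (X i : MvPowerSeries (Fin 4) k) :=
  (irreducible_X i).prime

theorem isWeightZeroSubring (hr : r ≠ 0) :
    IsWeightZeroSubring (homogeneousFamily k (weight r)) (embedding k r) (X 0) (X 1) where
  injective := embedding_injective
  homog_zero_iff z := (isWeightHomogeneous_zero_iff z).trans
    (Ideal.Quotient.mk_surjective.exists (p := fun x => embedding k r x = z)).symm
  prime_left := prime_X 0
  prime_right := prime_X 1
  homog_left d hd := by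
    classical
    rw [coeff_X] at hd
    rw [of_not_not fun h => hd (if_neg h)]
    simp [weight_apply]
  homog_right d hd := by
    classical
    rw [coeff_X] at hd
    rw [of_not_not fun h => hd (if_neg h)]
    simp [weight_apply]
  not_dvd := by simp [X_dvd_X_iff]
  exists_left := by
    refine ⟨Ideal.Quotient.mk _ (X 1), ?_, fun h => ?_⟩
    · rw [embedding_mk, param_X, generator_one]
      exact (dvd_pow_self _ hr).mul_right _
    · rw [embedding_mk, param_X, generator_one] at h
      rcases (prime_X 0).dvd_or_dvd h with h | h
      · simpa [X_dvd_X_iff] using (prime_X 0).dvd_of_dvd_pow h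
      · simp [X_dvd_X_iff] at h
  exists_right := by
    refine ⟨Ideal.Quotient.mk _ (X 0), ?_, fun h => ?_⟩
    · rw [embedding_mk, param_X, generator_zero]
      exact (dvd_pow_self _ hr).mul_right _
    · rw [embedding_mk, param_X, generator_zero] at h
      rcases (prime_X 1).dvd_or_dvd h with h | h
      · simpa [X_dvd_X_iff] using (prime_X 1).dvd_of_dvd_pow h
      · simp [X_dvd_X_iff] at h

theorem sum_range_eq_coeff (F : MvPowerSeries (Fin 4) k) (hr : r ≠ 0) (x y z : ℕ) :
    (∑ i ∈ Finset.range (z + 1),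
      if r * i ≤ 0 then coeff (quad (x + i) (y + i) (z - i) (0 - r * i)) F else 0) =
      coeff (quad x y z 0) F := by
  rw [Finset.sum_range_succ', Finset.sum_eq_zero]
  · simp
  · intro i _
    simp [hr]

theorem mk_mem_span_pair {F : MvPowerSeries (Fin 4) k} {i j : Fin 4}
    (hF : F ∈ Ideal.span {X i, X j}) (I : Ideal (MvPowerSeries (Fin 4) k)) :
    Ideal.Quotient.mk I F ∈ Ideal.span {Ideal.Quotient.mk I (X i), Ideal.Quotient.mk I (X j)} := by
  have := Ideal.mem_map_of_mem (Ideal.Quotient.mk I) hF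
  rwa [Ideal.map_span, Set.image_pair] at this

theorem comap_embedding_span_X_zero (hr : r ≠ 0) :
    (Ideal.span {X 0}).comap (embedding k r) = conePrime₁ k r := by
  refine le_antisymm (fun z hz => ?_) (Ideal.span_le.2 ?_)
  · obtain ⟨F, rfl⟩ := Ideal.Quotient.mk_surjective z
    rw [Ideal.mem_comap, Ideal.mem_span_singleton, embedding_mk] at hz
    refine mk_mem_span_pair (mem_span_X_pair fun d h0 h3 => ?_) _
    have := X_dvd_iff.1 hz (exponentMap r (quad 0 (d 1) (d 2) 0)) (by simp [exponentMap])
    rw [coeff_param_exponentMap F (Or.inl rfl), sum_range_eq_coeff F hr] at this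
    rwa [eq_quad d, h0, h3]
  · rintro _ (rfl | rfl) <;>
      rw [SetLike.mem_coe, Ideal.mem_comap, Ideal.mem_span_singleton, embedding_mk, param_X]
    · rw [generator_zero]
      exact (dvd_pow_self _ hr).mul_right _
    · rw [generator_three]
      exact dvd_mul_right _ _

theorem comap_embedding_span_X_one (hr : r ≠ 0) :
    (Ideal.span {X 1}).comap (embedding k r) = conePrime₂ k r := by
  refine le_antisymm (fun z hz => ?_) (Ideal.span_le.2 ?_)
  · obtain ⟨F, rfl⟩ := Ideal.Quotient.mk_surjective z
    rw [Ideal.mem_comap, Ideal.mem_span_singleton, embedding_mk] at hz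
    refine mk_mem_span_pair (mem_span_X_pair fun d h1 h3 => ?_) _
    have := X_dvd_iff.1 hz (exponentMap r (quad (d 0) 0 (d 2) 0)) (by simp [exponentMap])
    rw [coeff_param_exponentMap F (Or.inr rfl), sum_range_eq_coeff F hr] at this
    rwa [eq_quad d, h1, h3]
  · rintro _ (rfl | rfl) <;>
      rw [SetLike.mem_coe, Ideal.mem_comap, Ideal.mem_span_singleton, embedding_mk, param_X]
    · rw [generator_one]
      exact (dvd_pow_self _ hr).mul_right _
    · rw [generator_three]
      exact dvd_mul_left _ _

instance : IsDomain (MvPowerSeries (Fin 4) k) := NoZeroDivisors.to_isDomain _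

instance : IsDomain (ConeRing k r) := embedding_injective.isDomain

instance : IsLocalRing (ConeRing k r) :=
  IsLocalRing.of_surjective' (Ideal.Quotient.mk _) Ideal.Quotient.mk_surjective

end ConeRing

end Cone

theorem stmt_6 (k : Type) [Field k] (r : ℕ) (hr : 1 ≤ r) :
    IsDomain (ConeRing k r) ∧
    IsIntegrallyClosed (ConeRing k r) ∧
    IsLocalRing (ConeRing k r) ∧
    (∀ [IsLocalRing (ConeRing k r)],
      IsAdicComplete (IsLocalRing.maximalIdeal (ConeRing k r)) (ConeRing k r)) ∧
    (∀ [IsDomain (ConeRing k r)], Subsingleton (ClassGroup (ConeRing k r))) ∧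
    ∃ (h₁ : IsHeightOnePrime (ConeRing k r) (conePrime₁ k r))
      (h₂ : IsHeightOnePrime (ConeRing k r) (conePrime₂ k r))
      (e : WeilClassGroup (ConeRing k r) ≃+ ℤ),
      e (QuotientAddGroup.mk (Finsupp.single ⟨conePrime₁ k r, h₁⟩ 1)) = 1 ∧
      (QuotientAddGroup.mk (Finsupp.single ⟨conePrime₂ k r, h₂⟩ 1) :
          WeilClassGroup (ConeRing k r)) =
        - QuotientAddGroup.mk (Finsupp.single ⟨conePrime₁ k r, h₁⟩ 1) := by
  have hr0 : r ≠ 0 := Nat.one_le_iff_ne_zero.1 hr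
  have H := ConeRing.isWeightZeroSubring (k := k) hr0
  refine ⟨inferInstance, H.isIntegrallyClosed, inferInstance,
    IsLocalRing.isAdicComplete_of_surjective (Ideal.Quotient.mk _) Ideal.Quotient.mk_surjective,
    ClassGroup.subsingleton_of_isLocalRing _, ?_⟩
  rw [← ConeRing.comap_embedding_span_X_zero hr0, ← ConeRing.comap_embedding_span_X_one hr0]
  obtain ⟨h₁, h₂, e, he₁, he₂⟩ := H.exists_weilClassGroup_equiv
  exact ⟨h₁, h₂, e, he₁, e.injective (by rw [he₂, map_neg, he₁])⟩
end

section
/- Let k be a finitely generated field not contained in the algebraic closure of a finite field, and m ≥ 1. Then P^m(k) is not a thin set; in particular P^m(k) is not contained in a finite union of sets of the form f(X(k)) where f: X → P^m_k is a separable, generically finite morphism of k-varieties of degree ≥ 2 or with image a proper subvariety. -/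
open Polynomial Filter Topology Bornology

theorem exists_isAlgClosed_normedField_of_ratFunc (k : Type) [Field k] :
    ∃ (C : Type) (_ : NormedField C) (_ : IsAlgClosed C) (i : RatFunc k →+* C),
      (∀ p : k[X], p ≠ 0 → 1 ≤ ‖i (algebraMap k[X] (RatFunc k) p)‖) ∧
      1 < ‖i (algebraMap k[X] (RatFunc k) X)‖ := by
  classical
  let E := RatFunc.CompletionAtInfty k
  have hv (p : k[X]) (hp : p ≠ 0) :
      (Valued.v (algebraMap (RatFunc k) E (algebraMap k[X] (RatFunc k) p)) :
        WithZero (Multiplicative ℤ)) = WithZero.exp (p.natDegree : ℤ) := by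
    rw [RatFunc.valuedCompletionAtInfty.def]
    let := RatFunc.inftyValued k
    refine (Valued.extensionValuation_apply_coe _).trans ?_
    exact RatFunc.inftyValuation.polynomial k hp
  let v : Valuation E (WithZero (Multiplicative ℤ)) := Valued.v
  have hX : v (algebraMap (RatFunc k) E (algebraMap k[X] (RatFunc k) X)) = WithZero.exp 1 := by
    simpa using hv X X_ne_zero
  have hlt : (1 : WithZero (Multiplicative ℤ)) < WithZero.exp 1 := by
    rw [← WithZero.exp_zero, WithZero.exp_lt_exp]; norm_num
  have : v.IsNontrivial := ⟨_, hX ▸ WithZero.exp_ne_zero, hX ▸ hlt.ne'⟩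
  let : v.RankOne := (Valuation.nonempty_rankOne_iff_mulArchimedean.2
    (MulArchimedean.comap MonoidWithZeroHom.ValueGroup₀.embedding.toMonoidHom
      MonoidWithZeroHom.ValueGroup₀.embedding_strictMono)).some
  let : NontriviallyNormedField E := Valued.toNontriviallyNormedField E (WithZero (Multiplicative ℤ))
  have : CompleteSpace E := by
    let := RatFunc.inftyValued k
    exact inferInstanceAs (CompleteSpace (UniformSpace.Completion (RatFunc k)))
  have : IsUltrametricDist E := inferInstance
  let : NormedField (AlgebraicClosure E) := spectralNorm.normedField E (AlgebraicClosure E)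
  refine ⟨AlgebraicClosure E, this, AlgebraicClosure.isAlgClosed E,
    (algebraMap E (AlgebraicClosure E)).comp (algebraMap (RatFunc k) E), ?_, ?_⟩
  · intro p hp
    refine le_of_le_of_eq ?_ (spectralNorm_extends _).symm
    rw [Valued.toNormedField.one_le_norm_iff, hv p hp, ← WithZero.exp_zero, WithZero.exp_le_exp]
    positivity
  · refine lt_of_lt_of_eq ?_ (spectralNorm_extends _).symm
    rw [Valued.toNormedField.one_lt_norm_iff]
    exact hlt.trans_eq hX.symm

section Analysis

theorem eval_eval_eq_evalEval {R : Type*} [CommSemiring R] (h : R[X][X]) (P : R[X]) (x : R) :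
    (h.eval P).eval x = h.evalEval x (P.eval x) := by
  rw [← map_evalRingHom_eval, eval_map]
  exact (eval₂_hom (evalRingHom x) P).symm

theorem eval_reflect {K : Type*} [Field K] {p : K[X]} {e : ℕ} (hp : p.natDegree ≤ e) {n : K}
    (hn : n ≠ 0) : (p.reflect e).eval n = n ^ e * p.eval n⁻¹ := by
  let := invertibleOfNonzero (inv_ne_zero hn)
  have := eval₂_reflect_mul_pow (RingHom.id K) n⁻¹ e p hp
  rw [invOf_eq_inv, inv_inv, eval₂_id, eval₂_id] at this
  rw [← this, mul_comm, mul_assoc, ← mul_pow, inv_mul_cancel₀ hn, one_pow, mul_one]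

theorem evalEval_eq_sum {R : Type*} [CommSemiring R] (g : R[X][X]) (x y : R) :
    g.evalEval x y = ∑ i ∈ Finset.range (g.natDegree + 1), (g.coeff i).eval x * y ^ i := by
  rw [← map_evalRingHom_eval, eval_map, eval₂_eq_sum_range]
  rfl

theorem exists_approximate_root {R : Type*} [Field R] (g : R[X][X]) (a : R)
    (ha : g.evalEval 0 a = 0) (ha' : g.derivative.evalEval 0 a ≠ 0) (B : ℕ) :
    ∃ P : R[X], P.eval 0 = a ∧ X ^ B ∣ g.eval P := by
  suffices h : ∀ B : ℕ, ∃ P : R[X], P.eval 0 = a ∧ X ^ (B + 1) ∣ g.eval P from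
    (h B).imp fun P hP ↦ ⟨hP.1, (pow_dvd_pow _ B.le_succ).trans hP.2⟩
  intro B
  induction B with
  | zero =>
    refine ⟨C a, by simp, ?_⟩
    rw [zero_add, pow_one, X_dvd_iff, coeff_zero_eq_eval_zero]
    exact ha
  | succ B ih =>
    obtain ⟨P, hP, u, hu⟩ := ih
    set γ : R := -(u.eval 0) / g.derivative.evalEval 0 a
    obtain ⟨w, hw⟩ := g.binomExpansion P (C γ * X ^ (B + 1))
    refine ⟨P + C γ * X ^ (B + 1), by simp [hP], ?_⟩
    have : X ∣ u + g.derivative.eval P * C γ := by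
      rw [X_dvd_iff, coeff_zero_eq_eval_zero]
      rw [eval_add, eval_mul, eval_C, eval_eval_eq_evalEval, hP]
      simp only [γ]
      field_simp
      ring
    obtain ⟨v, hv⟩ := this
    rw [hw, hu]
    refine ⟨v + w * C γ ^ 2 * X ^ B, ?_⟩
    linear_combination X ^ (B + 1) * hv

variable {C : Type*} [NormedField C]

theorem continuous_evalEval (g : C[X][X]) : Continuous fun p : C × C ↦ g.evalEval p.1 p.2 := by
  simp_rw [evalEval_eq_sum]
  refine continuous_finsetSum _ fun i _ ↦ ?_
  exact ((g.coeff i).continuous.comp continuous_fst).mul (continuous_snd.pow i)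

theorem exists_eventually_norm_sub_le (g : C[X][X]) (a : C)
    (ha : g.evalEval 0 a = 0) (ha' : g.derivative.evalEval 0 a ≠ 0) (B : ℕ) :
    ∃ (P : C[X]) (M : ℝ), ∀ᶠ p : C × C in 𝓝 (0, a), g.evalEval p.1 p.2 = 0 →
      ‖p.2 - P.eval p.1‖ ≤ M * ‖p.1‖ ^ B := by
  obtain ⟨P, hP, u, hu⟩ := exists_approximate_root g a ha ha' B
  obtain ⟨h, hh⟩ : X - Polynomial.C P ∣ g - Polynomial.C (g.eval P) := X_sub_C_dvd_sub_C_eval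
  have hh' : g = Polynomial.C (g.eval P) + (X - Polynomial.C P) * h := by rw [← hh]; ring
  have hne : h.evalEval 0 a ≠ 0 := by
    have h1 : g.derivative.eval P = h.eval P := by
      conv_lhs => rw [hh']
      simp
    rwa [← hP, ← eval_eval_eq_evalEval, ← h1, eval_eval_eq_evalEval, hP]
  set c : ℝ := ‖h.evalEval 0 a‖ with hc
  have hc0 : 0 < c := norm_pos_iff.2 hne
  have e1 : ∀ᶠ p : C × C in 𝓝 (0, a), c / 2 < ‖h.evalEval p.1 p.2‖ :=
    (continuous_evalEval h).norm.continuousAt.eventually (lt_mem_nhds (half_lt_self hc0))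
  have e2 : ∀ᶠ p : C × C in 𝓝 (0, a), ‖u.eval p.1‖ < ‖u.eval 0‖ + 1 :=
    (u.continuous.comp continuous_fst).norm.continuousAt.eventually
      (gt_mem_nhds (lt_add_one _))
  refine ⟨P, 2 * (‖u.eval 0‖ + 1) / c, ?_⟩
  filter_upwards [e1, e2] with p h1 h2 h0
  have h3 : (p.2 - P.eval p.1) * h.evalEval p.1 p.2 = - (p.1 ^ B * u.eval p.1) := by
    have h4 := congrArg (evalEval p.1 p.2) hh'
    rw [h0, hu] at h4
    simp only [evalEval_add, evalEval_C, evalEval_mul, evalEval_sub, evalEval_X, eval_mul,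
      eval_pow, eval_X] at h4
    linear_combination -h4
  have h5 := congrArg norm h3
  rw [norm_mul, norm_neg, norm_mul, norm_pow] at h5
  have h6 : ‖p.2 - P.eval p.1‖ * (c / 2) ≤ ‖p.1‖ ^ B * (‖u.eval 0‖ + 1) := by
    calc _ ≤ ‖p.2 - P.eval p.1‖ * ‖h.evalEval p.1 p.2‖ := by gcongr
      _ = ‖p.1‖ ^ B * ‖u.eval p.1‖ := h5
      _ ≤ _ := by gcongr
  rw [div_mul_eq_mul_div, le_div_iff₀ hc0]
  linarith

theorem exists_eventually_norm_root_le (g : C[X][X]) (hlc : g.leadingCoeff.eval 0 ≠ 0) :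
    ∃ R : ℝ, ∀ᶠ s : C in 𝓝 0, ∀ y : C, g.evalEval s y = 0 → ‖y‖ ≤ R := by
  set c : ℝ := ‖g.leadingCoeff.eval 0‖
  have hc0 : 0 < c := norm_pos_iff.2 hlc
  have e1 : ∀ᶠ s : C in 𝓝 0, c / 2 < ‖g.leadingCoeff.eval s‖ :=
    g.leadingCoeff.continuous.norm.continuousAt.eventually (lt_mem_nhds (half_lt_self hc0))
  have e2 : ∀ᶠ s : C in 𝓝 0, ∀ i ∈ Finset.range g.natDegree,
      ‖(g.coeff i).eval s‖ < ‖(g.coeff i).eval 0‖ + 1 := by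
    rw [Filter.eventually_all_finset]
    exact fun i _ ↦ (g.coeff i).continuous.norm.continuousAt.eventually
      (gt_mem_nhds (lt_add_one _))
  set A : ℝ := ∑ i ∈ Finset.range g.natDegree, (‖(g.coeff i).eval 0‖ + 1)
  refine ⟨max 1 (2 * A / c), ?_⟩
  filter_upwards [e1, e2] with s h1 h2 y hy
  rcases le_total ‖y‖ 1 with hy1 | hy1
  · exact le_max_of_le_left hy1
  refine le_max_of_le_right ?_
  rw [evalEval_eq_sum, Finset.sum_range_succ] at hy
  have hy' : g.leadingCoeff.eval s * y ^ g.natDegree =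
      -∑ i ∈ Finset.range g.natDegree, (g.coeff i).eval s * y ^ i := by
    rw [leadingCoeff]; linear_combination hy
  rcases Nat.eq_zero_or_pos g.natDegree with hd | hd
  · simp only [hd, pow_zero, Finset.range_zero, Finset.sum_empty, neg_zero, mul_one] at hy'
    rw [hy', norm_zero] at h1
    linarith
  have h3 : ‖g.leadingCoeff.eval s‖ * ‖y‖ ^ g.natDegree ≤ A * ‖y‖ ^ (g.natDegree - 1) := by
    rw [← norm_pow, ← norm_mul, hy', norm_neg, Finset.sum_mul]
    refine norm_sum_le_of_le _ fun i hi ↦ ?_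
    rw [norm_mul, norm_pow]
    have := h2 i hi
    have : i ≤ g.natDegree - 1 := by have := Finset.mem_range.1 hi; omega
    gcongr
  have h4 : ‖y‖ ^ g.natDegree = ‖y‖ ^ (g.natDegree - 1) * ‖y‖ := by
    rw [← pow_succ, Nat.sub_add_cancel hd]
  have h5 : 0 < ‖y‖ ^ (g.natDegree - 1) := by positivity
  have h6 : ‖g.leadingCoeff.eval s‖ * ‖y‖ ≤ A := by
    refine le_of_mul_le_mul_right ?_ h5
    rw [h4] at h3
    linarith
  rw [le_div_iff₀ hc0]
  nlinarith [norm_nonneg y]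

theorem eventually_exists_root_mem (g : C[X][X]) (hs : (g.map (evalRingHom 0)).Splits)
    (hlc : g.leadingCoeff.eval 0 ≠ 0) {ρ : ℝ} (hρ : 0 < ρ) :
    ∀ᶠ s : C in 𝓝 0, ∀ y : C, g.evalEval s y = 0 →
      ∃ a ∈ (g.map (evalRingHom 0)).roots, ‖y - a‖ < ρ := by
  set f := g.map (evalRingHom 0)
  have hf : f.leadingCoeff = g.leadingCoeff.eval 0 :=
    leadingCoeff_map_of_leadingCoeff_ne_zero _ hlc
  obtain ⟨R, hR⟩ := exists_eventually_norm_root_le g hlc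
  have hlim : Tendsto (fun s : C ↦ ∑ i ∈ Finset.range (g.natDegree + 1),
      ‖(g.coeff i).eval s - (g.coeff i).eval 0‖ * R ^ i) (𝓝 0) (𝓝 0) := by
    have : Continuous (fun s : C ↦ ∑ i ∈ Finset.range (g.natDegree + 1),
      ‖(g.coeff i).eval s - (g.coeff i).eval 0‖ * R ^ i) :=
      continuous_finsetSum _ fun i _ ↦
        (((g.coeff i).continuous.sub continuous_const).norm.mul continuous_const)
    simpa using this.tendsto 0
  set ε : ℝ := ‖f.leadingCoeff‖ * ρ ^ f.roots.card
  have hε : 0 < ε := by rw [← hf] at hlc; positivity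
  filter_upwards [hR, hlim.eventually (gt_mem_nhds hε)] with s h1 h2 y hy
  by_contra! hcon
  have hyR := h1 y hy
  have h3 : ‖f.eval y‖ < ε := by
    refine lt_of_le_of_lt ?_ h2
    have h4 : f.eval y = -∑ i ∈ Finset.range (g.natDegree + 1),
        ((g.coeff i).eval s - (g.coeff i).eval 0) * y ^ i := by
      rw [map_evalRingHom_eval, ← zero_sub, ← hy, evalEval_eq_sum, evalEval_eq_sum]
      simp [sub_mul]
    rw [h4, norm_neg]
    refine norm_sum_le_of_le _ fun i _ ↦ ?_
    rw [norm_mul, norm_pow]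
    gcongr
  have h5 : ρ ^ f.roots.card ≤ ‖(f.roots.map (y - ·)).prod‖ := by
    generalize f.roots = m at hcon
    induction m using Multiset.induction_on with
    | empty => simp
    | cons a m ih =>
      rw [Multiset.card_cons, Multiset.map_cons, Multiset.prod_cons, norm_mul, pow_succ']
      have := hcon a (Multiset.mem_cons_self a m)
      have := ih fun b hb ↦ hcon b (Multiset.mem_cons_of_mem hb)
      gcongr
  rw [hs.eval_eq_prod_roots, norm_mul] at h3
  exact absurd h3 (not_lt.2 (mul_le_mul_of_nonneg_left h5 (norm_nonneg _)))

theorem exists_finset_branches [IsAlgClosed C] (g : C[X][X])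
    (hsep : (g.map (evalRingHom 0)).Separable) (hlc : g.leadingCoeff.eval 0 ≠ 0) (B : ℕ) :
    ∃ (S : Finset C[X]) (M : ℝ), ∀ᶠ s : C in 𝓝 0, ∀ y : C, g.evalEval s y = 0 →
      ∃ P ∈ S, ‖y - P.eval s‖ ≤ M * ‖s‖ ^ B := by
  classical
  set f := g.map (evalRingHom 0) with hf
  have hroot (a : C) (ha : a ∈ f.roots.toFinset) :
      ∃ (P : C[X]) (M : ℝ), ∀ᶠ p : C × C in 𝓝 (0, a), g.evalEval p.1 p.2 = 0 →
        ‖p.2 - P.eval p.1‖ ≤ M * ‖p.1‖ ^ B := by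
    have ha := isRoot_of_mem_roots (Multiset.mem_toFinset.1 ha)
    refine exists_eventually_norm_sub_le g a (by rw [← map_evalRingHom_eval]; exact ha) ?_ B
    rw [← map_evalRingHom_eval, ← derivative_map]
    exact hsep.eval₂_derivative_ne_zero (RingHom.id C) ha
  choose! P M hPM using hroot
  have hr : ∃ r > 0, ∀ a ∈ f.roots.toFinset, ∀ p : C × C, ‖p.1‖ < r → ‖p.2 - a‖ < r →
      g.evalEval p.1 p.2 = 0 → ‖p.2 - (P a).eval p.1‖ ≤ M a * ‖p.1‖ ^ B := by
    have : ∀ᶠ r : ℝ in 𝓝[>] 0, ∀ a ∈ f.roots.toFinset, ∀ p : C × C, ‖p.1‖ < r → ‖p.2 - a‖ < r →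
      g.evalEval p.1 p.2 = 0 → ‖p.2 - (P a).eval p.1‖ ≤ M a * ‖p.1‖ ^ B := by
      rw [Filter.eventually_all_finset]
      intro a ha
      obtain ⟨r, hr, h⟩ := Metric.eventually_nhds_iff.1 (hPM a ha)
      filter_upwards [Ioo_mem_nhdsGT hr] with r' hr' p h1 h2
      refine h ?_
      rw [Prod.dist_eq, max_lt_iff, dist_eq_norm, dist_eq_norm, sub_zero]
      exact ⟨h1.trans hr'.2, h2.trans hr'.2⟩
    obtain ⟨r, h1, h2⟩ := (this.and self_mem_nhdsWithin).exists
    exact ⟨r, h2, h1⟩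
  obtain ⟨r, hr0, hr⟩ := hr
  refine ⟨f.roots.toFinset.image P, ∑ a ∈ f.roots.toFinset, |M a|, ?_⟩
  filter_upwards [eventually_exists_root_mem g (IsAlgClosed.splits _) hlc hr0,
    Metric.ball_mem_nhds 0 hr0] with s h1 h2 y hy
  obtain ⟨a, ha, hya⟩ := h1 y hy
  have ha := Multiset.mem_toFinset.2 ha
  refine ⟨P a, Finset.mem_image_of_mem _ ha,
    (hr a ha (s, y) (by simpa using h2) hya hy).trans ?_⟩
  gcongr
  exact (le_abs_self _).trans (Finset.single_le_sum (f := fun a ↦ |M a|) (fun _ _ ↦ abs_nonneg _) ha)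

/-- At a point `s = 1 / n` close to zero, the integral multiple of a root of `g(s, Y)` is
close to the value at `n` of one of finitely many polynomials of bounded degree. -/
theorem exists_finset_polynomial_approximation [IsAlgClosed C] (g : C[X][X])
    (hsep : (g.map (evalRingHom 0)).Separable) (hlc : g.leadingCoeff.eval 0 ≠ 0)
    (l : C[X]) (e : ℕ) :
    ∃ S : Finset C[X], (∀ Q ∈ S, Q.natDegree ≤ e) ∧ ∀ δ > 0, ∀ᶠ n : C in cobounded C,
      ∀ y : C, g.evalEval n⁻¹ y = 0 → ∃ Q ∈ S, ‖n ^ e * l.eval n⁻¹ * y - Q.eval n‖ < δ := by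
  classical
  obtain ⟨S, M, h⟩ := exists_finset_branches g hsep hlc (e + 1)
  let U (P : C[X]) : C[X] := (l * P) %ₘ X ^ (e + 1)
  let V (P : C[X]) : C[X] := (l * P) /ₘ X ^ (e + 1)
  have hU (P : C[X]) : (U P).natDegree ≤ e := by
    have := natDegree_modByMonic_lt (l * P) (monic_X_pow (R := C) (e + 1))
      (by intro h; simpa using congrArg natDegree h)
    rw [natDegree_X_pow] at this
    exact Nat.lt_succ_iff.1 this
  have hUV (P : C[X]) : l * P = U P + X ^ (e + 1) * V P := (modByMonic_add_div _ _).symm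
  have hQ (P : C[X]) {n : C} (hn : n ≠ 0) :
      ((U P).reflect e).eval n = n ^ e * (U P).eval n⁻¹ :=
    eval_reflect (hU P) hn
  refine ⟨S.image fun P ↦ (U P).reflect e, ?_, ?_⟩
  · simp only [Finset.mem_image, forall_exists_index, and_imp, forall_apply_eq_imp_iff₂]
    intro P _
    exact (natDegree_reflect_le).trans (by simp [hU P])
  intro δ hδ
  have hlim : Tendsto (fun s : C ↦ ‖s‖ * (‖l.eval s‖ * M + ∑ P ∈ S, ‖(V P).eval s‖))
      (𝓝 0) (𝓝 0) := by
    have : Continuous (fun s : C ↦ ‖s‖ * (‖l.eval s‖ * M + ∑ P ∈ S, ‖(V P).eval s‖)) :=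
      continuous_norm.mul ((l.continuous.norm.mul continuous_const).add
        (continuous_finsetSum _ fun P _ ↦ (V P).continuous.norm))
    simpa using this.tendsto 0
  have hinv : Tendsto (fun n : C ↦ n⁻¹) (cobounded C) (𝓝 0) := tendsto_inv₀_cobounded
  filter_upwards [hinv.eventually h, hinv.eventually (hlim.eventually (gt_mem_nhds hδ)),
    eventually_ne_cobounded 0] with n h1 h2 hn y hy
  obtain ⟨P, hP, hyP⟩ := h1 y hy
  refine ⟨_, Finset.mem_image_of_mem _ hP, lt_of_le_of_lt ?_ h2⟩
  rw [hQ P hn]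
  have h3 : n ^ e * l.eval n⁻¹ * y - n ^ e * (U P).eval n⁻¹ =
      n ^ e * l.eval n⁻¹ * (y - P.eval n⁻¹) + n⁻¹ * (V P).eval n⁻¹ := by
    have h4 := congrArg (eval n⁻¹) (hUV P)
    simp only [eval_mul, eval_add, eval_pow, eval_X] at h4
    have h5 : n ^ e * n⁻¹ ^ (e + 1) = n⁻¹ := by
      rw [pow_succ, ← mul_assoc, ← mul_pow, mul_inv_cancel₀ hn, one_pow, one_mul]
    linear_combination n ^ e * h4 + h5 * (V P).eval n⁻¹
  have h6 : ‖n‖ ^ e * ‖n⁻¹‖ ^ (e + 1) = ‖n⁻¹‖ := by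
    rw [pow_succ, ← mul_assoc, ← mul_pow, ← norm_mul, mul_inv_cancel₀ hn, norm_one, one_pow,
      one_mul]
  rw [h3]
  calc _ ≤ ‖n ^ e * l.eval n⁻¹ * (y - P.eval n⁻¹)‖ + ‖n⁻¹ * (V P).eval n⁻¹‖ := norm_add_le _ _
    _ = ‖n‖ ^ e * ‖l.eval n⁻¹‖ * ‖y - P.eval n⁻¹‖ + ‖n⁻¹‖ * ‖(V P).eval n⁻¹‖ := by
      simp only [norm_mul, norm_pow]
    _ ≤ ‖n‖ ^ e * ‖l.eval n⁻¹‖ * (M * ‖n⁻¹‖ ^ (e + 1)) +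
        ‖n⁻¹‖ * ∑ P ∈ S, ‖(V P).eval n⁻¹‖ := by
      gcongr
      exact Finset.single_le_sum (f := fun P ↦ ‖(V P).eval n⁻¹‖) (fun _ _ ↦ norm_nonneg _) hP
    _ = _ := by linear_combination ‖l.eval n⁻¹‖ * M * h6

end Analysis

section Integral

variable {O F K C : Type*} [CommRing O] [IsDomain O] [IsIntegrallyClosed O] [Field F] [Field K]
  [Algebra O F] [IsFractionRing O F] [Algebra F K] [Algebra O K] [IsScalarTower O F K]
  [FiniteDimensional F K] [NormedField C] [IsAlgClosed C] [Algebra F C] [Algebra O C]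
  [IsScalarTower O F C]

theorem eq_zero_of_isIntegral_of_norm_lt_one (hO : ∀ a : O, a ≠ 0 → 1 ≤ ‖algebraMap O C a‖)
    {w : K} (hw : IsIntegral O w) (h : ∀ σ : K →ₐ[F] C, ‖σ w‖ < 1) : w = 0 := by
  have hwF : IsIntegral F w := Algebra.IsIntegral.isIntegral w
  have hmap : minpoly F w = (minpoly O w).map (algebraMap O F) :=
    minpoly.isIntegrallyClosed_eq_field_fractions' F hw
  have hroot (r : C) (hr : r ∈ ((minpoly F w).map (algebraMap F C)).roots) : ‖r‖ < 1 := by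
    have : r ∈ (minpoly F w).rootSet C := by
      rw [mem_rootSet]
      refine ⟨minpoly.ne_zero hwF, ?_⟩
      rw [← eval_map_algebraMap]
      exact isRoot_of_mem_roots hr
    rw [← Algebra.IsAlgebraic.range_eval_eq_rootSet_minpoly] at this
    obtain ⟨σ, rfl⟩ := this
    exact h σ
  have hcoeff : ‖algebraMap O C ((minpoly O w).coeff 0)‖ < 1 := by
    have h1 : algebraMap O C ((minpoly O w).coeff 0) =
        ((minpoly F w).map (algebraMap F C)).coeff 0 := by
      rw [hmap, Polynomial.map_map, coeff_map, ← IsScalarTower.algebraMap_eq]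
    have h2 := (IsAlgClosed.splits ((minpoly F w).map (algebraMap F C)))
    have h3 := h2.coeff_zero_eq_prod_roots_of_monic ((minpoly.monic hwF).map _)
    rw [h1, h3, norm_mul, norm_pow, norm_neg, norm_one, one_pow, one_mul]
    have h4 : ((minpoly F w).map (algebraMap F C)).roots ≠ 0 := by
      rw [← Multiset.card_pos, ← h2.natDegree_eq_card_roots, natDegree_map]
      exact minpoly.natDegree_pos hwF
    generalize ((minpoly F w).map (algebraMap F C)).roots = m at hroot h4
    induction m using Multiset.induction_on with
    | empty => exact absurd rfl h4
    | cons a m ih =>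
      rw [Multiset.prod_cons, norm_mul]
      have h5 := hroot a (Multiset.mem_cons_self a m)
      by_cases hm : m = 0
      · simpa [hm] using h5
      · exact mul_lt_one_of_nonneg_of_lt_one_left (norm_nonneg _) h5
          (ih (fun r hr ↦ hroot r (Multiset.mem_cons_of_mem hr)) hm).le
  have h0 : (minpoly O w).coeff 0 = 0 := by
    by_contra h0
    exact absurd hcoeff (not_lt.2 (hO _ h0))
  rw [← minpoly.coeff_zero_eq_zero hwF, hmap, coeff_map, h0, map_zero]

theorem lagrange_basis_map {F K ι : Type*} [Field F] [Field K] [DecidableEq ι] (φ : F →+* K)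
    (s : Finset ι) (v : ι → F) (i : ι) :
    (Lagrange.basis s v i).map φ = Lagrange.basis s (fun j ↦ φ (v j)) i := by
  simp [Lagrange.basis, Lagrange.basisDivisor, Polynomial.map_prod]

theorem eval_add_eq_sum_lagrange {F ι : Type*} [Field F] [DecidableEq ι] (s : Finset ι)
    (v : ι → F) (hv : Set.InjOn v s) (Q : F[X]) (hQ : Q.natDegree < s.card) (a x : F) :
    Q.eval (a + x) = ∑ i ∈ s, (Lagrange.basis s v i).eval x * Q.eval (a + v i) := by
  have h1 : (Q.comp (C a + X)).degree < s.card := by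
    refine degree_le_natDegree.trans_lt (Nat.cast_lt.2 ?_)
    rwa [natDegree_comp, add_comm, natDegree_X_add_C, mul_one]
  have h := congrArg (eval x) (Lagrange.eq_interpolate hv h1)
  simp [Lagrange.interpolate_apply, eval_finsetSum] at h
  rw [h]
  exact Finset.sum_congr rfl fun _ _ ↦ mul_comm _ _

theorem eventually_eq_sum_lagrange {ι : Type*} [DecidableEq ι]
    (hO : ∀ a : O, a ≠ 0 → 1 ≤ ‖algebraMap O C a‖) (s : Finset ι) (ε : ι → O)
    (hε : Function.Injective ε) (l : ι) :
    ∀ᶠ δ : ℝ in 𝓝[>] 0, ∀ (n : O) (w : ι → K), (∀ i ∈ insert l s, IsIntegral O (w i)) →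
      (∀ σ : K →ₐ[F] C, ∃ Q : C[X], Q.natDegree < s.card ∧
        ∀ i ∈ insert l s, ‖σ (w i) - Q.eval (algebraMap O C (n + ε i))‖ < δ) →
      w l = ∑ i ∈ s, (Lagrange.basis s (fun j ↦ algebraMap O K (ε j)) i).eval
        (algebraMap O K (ε l)) * w i := by
  set lam : ι → F := fun i ↦
    (Lagrange.basis s (fun j ↦ algebraMap O F (ε j)) i).eval (algebraMap O F (ε l)) with hlam
  have hlamK (i : ι) : (Lagrange.basis s (fun j ↦ algebraMap O K (ε j)) i).eval
        (algebraMap O K (ε l)) = algebraMap F K (lam i) := by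
    simp only [hlam, IsScalarTower.algebraMap_apply O F K]
    rw [← lagrange_basis_map, eval_map_apply]
  have hlamC (i : ι) : (Lagrange.basis s (fun j ↦ algebraMap O C (ε j)) i).eval
        (algebraMap O C (ε l)) = algebraMap F C (lam i) := by
    simp only [hlam, IsScalarTower.algebraMap_apply O F C]
    rw [← lagrange_basis_map, eval_map_apply]
  have hOC : Function.Injective (algebraMap O C) := by
    rw [IsScalarTower.algebraMap_eq O F C]
    exact (algebraMap F C).injective.comp (IsFractionRing.injective O F)
  obtain ⟨V, hV⟩ := IsLocalization.exist_integer_multiples (nonZeroDivisors O) s lam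
  have hV0 : (V : O) ≠ 0 := nonZeroDivisors.ne_zero V.2
  set Λ : ℝ := ‖algebraMap O C V‖ * (1 + ∑ i ∈ s, ‖algebraMap F C (lam i)‖)
  have hΛ : 0 < Λ := by
    have := hO V hV0
    have : 0 ≤ ∑ i ∈ s, ‖algebraMap F C (lam i)‖ := Finset.sum_nonneg fun _ _ ↦ norm_nonneg _
    positivity
  filter_upwards [Ioo_mem_nhdsGT (inv_pos.2 hΛ)] with δ hδ n w hw hσ
  simp_rw [hlamK]
  have hz : algebraMap O K V * (w l - ∑ i ∈ s, algebraMap F K (lam i) * w i) = 0 := by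
    refine eq_zero_of_isIntegral_of_norm_lt_one (F := F) (C := C) hO ?_ fun σ ↦ ?_
    · rw [mul_sub, Finset.mul_sum]
      refine (isIntegral_algebraMap.mul (hw l (Finset.mem_insert_self _ _))).sub
        (IsIntegral.sum _ fun i hi ↦ ?_)
      obtain ⟨a, ha⟩ := hV i hi
      rw [← mul_assoc, IsScalarTower.algebraMap_apply O F K, ← map_mul,
        ← Algebra.smul_def (V : O) (lam i), ← ha,
        ← IsScalarTower.algebraMap_apply O F K]
      exact isIntegral_algebraMap.mul (hw i (Finset.mem_insert_of_mem hi))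
    · obtain ⟨Q, hQ, hQw⟩ := hσ σ
      have h1 := eval_add_eq_sum_lagrange s (fun j ↦ algebraMap O C (ε j))
        ((hOC.comp hε).injOn) Q hQ
        (algebraMap O C n) (algebraMap O C (ε l))
      simp_rw [hlamC, ← map_add] at h1
      have h2 : σ (algebraMap O K V * (w l - ∑ i ∈ s, algebraMap F K (lam i) * w i)) =
          algebraMap O C V * ((σ (w l) - Q.eval (algebraMap O C (n + ε l))) -
            ∑ i ∈ s, algebraMap F C (lam i) *
              (σ (w i) - Q.eval (algebraMap O C (n + ε i)))) := by
        simp only [h1, map_mul, map_sub, map_sum, AlgHom.commutes,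
          IsScalarTower.algebraMap_apply O F K, ← IsScalarTower.algebraMap_apply O F C, mul_sub,
          Finset.sum_sub_distrib]
        ring
      rw [h2]
      calc _ ≤ ‖algebraMap O C V‖ * (δ + ∑ i ∈ s, ‖algebraMap F C (lam i)‖ * δ) := by
            rw [norm_mul]
            gcongr
            refine (norm_sub_le _ _).trans ?_
            refine add_le_add (hQw l (Finset.mem_insert_self _ _)).le ?_
            refine norm_sum_le_of_le _ fun i hi ↦ ?_
            rw [norm_mul]
            have := hQw i (Finset.mem_insert_of_mem hi)
            gcongr
        _ = Λ * δ := by rw [← Finset.sum_mul]; ring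
        _ < Λ * Λ⁻¹ := by
            have := hδ.2
            gcongr
        _ = 1 := mul_inv_cancel₀ hΛ.ne'
  have hVK : algebraMap O K V ≠ 0 := by
    rw [IsScalarTower.algebraMap_apply O F K]
    simp
  exact sub_eq_zero.1 ((mul_eq_zero.1 hz).resolve_left hVK)

end Integral

section Predicates

/-- `f` has no root in the fraction field of `R`. -/
def NoFractionRoot {R : Type*} [CommRing R] (f : R[X]) : Prop :=
  ∀ p q : R, q ≠ 0 → (f.scaleRoots q).eval p ≠ 0

/-- `f` becomes separable over every field in which a suitable nonzero `d` is invertible. -/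
def GenericallySeparable {R : Type*} [CommRing R] (f : R[X]) : Prop :=
  ∃ d : R, d ≠ 0 ∧ ∃ a b : R[X], a * f + b * derivative f = C d

theorem evalEval_scaleRoots_mul {R : Type*} [CommRing R] (f : R[X][X]) (s : R[X]) (t y : R) :
    (f.scaleRoots s).evalEval t (s.eval t * y) = s.eval t ^ f.natDegree * f.evalEval t y := by
  rw [← map_evalRingHom_eval, ← map_evalRingHom_eval, eval_map, eval_map]
  exact scaleRoots_eval₂_mul (p := f) (evalRingHom t) y s

theorem NoFractionRoot.ne_zero {R : Type*} [CommRing R] [Nontrivial R] {f : R[X]}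
    (hf : NoFractionRoot f) : f ≠ 0 := by
  rintro rfl
  exact hf 0 1 one_ne_zero (by simp)

theorem GenericallySeparable.map {R S : Type*} [CommRing R] [CommRing S] {f : R[X]}
    (hf : GenericallySeparable f) (φ : R →+* S) (hφ : Function.Injective φ) :
    GenericallySeparable (f.map φ) := by
  obtain ⟨d, hd, a, b, h⟩ := hf
  refine ⟨φ d, by rwa [Ne, map_eq_zero_iff φ hφ], a.map φ, b.map φ, ?_⟩
  rw [derivative_map, ← Polynomial.map_mul, ← Polynomial.map_mul, ← Polynomial.map_add, h, map_C]

theorem separable_map_of_bezout {R K : Type*} [CommRing R] [Field K] {f a b : R[X]} {d : R}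
    (h : a * f + b * derivative f = C d) (φ : R →+* K) (hd : φ d ≠ 0) :
    (f.map φ).Separable := by
  refine ⟨C (φ d)⁻¹ * a.map φ, C (φ d)⁻¹ * b.map φ, ?_⟩
  have := congrArg (Polynomial.map φ) h
  rw [Polynomial.map_add, Polynomial.map_mul, Polynomial.map_mul, map_C, ← derivative_map] at this
  rw [mul_assoc, mul_assoc, ← mul_add, this, ← C_mul, inv_mul_cancel₀ hd, C_1]

theorem natDegree_scaleRoots_eval_le {R : Type*} [CommRing R] (f : R[X][X]) (s p : R[X])
    (e : ℕ) (hf : ∀ i, (f.coeff i).natDegree ≤ e) (hs : s.natDegree ≤ e) (hp : p.natDegree ≤ e) :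
    ((f.scaleRoots s).eval p).natDegree ≤ e * (f.natDegree + 1) := by
  rw [eval_eq_sum_range, natDegree_scaleRoots]
  refine natDegree_sum_le_of_forall_le _ _ fun i hi ↦ ?_
  have hi := Finset.mem_range.1 hi
  rw [coeff_scaleRoots]
  refine natDegree_mul_le.trans ?_
  refine (add_le_add (natDegree_mul_le.trans (add_le_add (hf i) (natDegree_pow_le.trans
    (Nat.mul_le_mul_left _ hs)))) (natDegree_pow_le.trans (Nat.mul_le_mul_left _ hp))).trans ?_
  rw [add_assoc, ← add_mul, Nat.sub_add_cancel (by omega), mul_comm]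
  exact le_of_eq (by ring)

end Predicates

section OneVariable

theorem exists_isIntegral_mul_of_root (O F : Type*) {K : Type*} [CommRing O] [IsDomain O]
    [Field F] [Field K] [Algebra O F] [IsFractionRing O F] [Algebra F K] [Algebra O K]
    [IsScalarTower O F K] [FiniteDimensional F K] (f : K[X][X]) (e : ℕ)
    (he : ∀ i, (f.coeff i).natDegree ≤ e) :
    ∃ c : K, c ≠ 0 ∧ ∀ n : O, n ≠ 0 → ∀ y : K, f.evalEval (algebraMap O K n)⁻¹ y = 0 →
      IsIntegral O (c * algebraMap O K n ^ e * f.leadingCoeff.eval (algebraMap O K n)⁻¹ * y) := by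
  classical
  have hOK : Function.Injective (algebraMap O K) := by
    rw [IsScalarTower.algebraMap_eq O F K]
    exact (algebraMap F K).injective.comp (IsFractionRing.injective O F)
  have : IsFractionRing (integralClosure O K) K :=
    integralClosure.isFractionRing_of_finite_extension F K
  let s : Finset K := f.support.biUnion fun i ↦ (f.coeff i).support.image (f.coeff i).coeff
  obtain ⟨c, hc⟩ := IsLocalization.exist_integer_multiples_of_finset
    (nonZeroDivisors (integralClosure O K)) s
  have hcoeff (i j : ℕ) : IsIntegral O ((c : integralClosure O K) * (f.coeff i).coeff j : K) := by
    by_cases hi : (f.coeff i).coeff j = 0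
    · rw [hi, mul_zero]
      exact isIntegral_zero
    obtain ⟨a, ha⟩ := hc ((f.coeff i).coeff j) (by
      refine Finset.mem_biUnion.2 ⟨i, ?_, Finset.mem_image.2 ⟨j, mem_support_iff.2 hi, rfl⟩⟩
      rw [mem_support_iff]
      intro h
      simp [h] at hi)
    have : ((c : integralClosure O K) * (f.coeff i).coeff j : K) = a := by
      exact ha.symm
    rw [this]
    exact a.2
  refine ⟨(c : integralClosure O K), ?_, fun n hn y hy ↦ ?_⟩
  · simp
  set ν := algebraMap O K n with hν
  have hν0 : ν ≠ 0 := by rwa [Ne, hν, map_eq_zero_iff _ hOK]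
  have hint (i : ℕ) : IsIntegral O ((c : integralClosure O K) * (ν ^ e * (f.coeff i).eval ν⁻¹) : K) := by
    rw [← eval_reflect (he i) hν0, eval_eq_sum, sum_def, Finset.mul_sum]
    refine IsIntegral.sum _ fun j _ ↦ ?_
    rw [coeff_reflect, ← mul_assoc]
    exact (hcoeff _ _).mul (isIntegral_algebraMap.pow _)
  let h (i : ℕ) : integralClosure O K := ⟨_, hint i⟩
  have hw : ((c : integralClosure O K) * ν ^ e * f.leadingCoeff.eval ν⁻¹ * y : K) =
      h f.natDegree * y := by
    simp only [h, leadingCoeff]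
    ring
  rw [hw]
  by_cases h0 : h f.natDegree = 0
  · rw [h0, ZeroMemClass.coe_zero, zero_mul]
    exact isIntegral_zero
  let H : (integralClosure O K)[X] := ∑ i ∈ Finset.range (f.natDegree + 1), monomial i (h i)
  have hH : H.coeff f.natDegree = h f.natDegree := by
    simp [H, coeff_monomial]
  have hHd : H.natDegree = f.natDegree := by
    refine natDegree_eq_of_le_of_coeff_ne_zero ?_ (hH ▸ h0)
    refine natDegree_sum_le_of_forall_le _ _ fun i hi ↦ (natDegree_monomial_le _).trans ?_
    exact Nat.lt_succ_iff.1 (Finset.mem_range.1 hi)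
  have hHy : aeval y H = 0 := by
    simp only [H, map_sum, aeval_monomial]
    rw [evalEval_eq_sum] at hy
    calc _ = ∑ i ∈ Finset.range (f.natDegree + 1), ((c : integralClosure O K) : K) * ν ^ e *
          ((f.coeff i).eval ν⁻¹ * y ^ i) := by
          refine Finset.sum_congr rfl fun i _ ↦ ?_
          change ((c : integralClosure O K) * (ν ^ e * (f.coeff i).eval ν⁻¹) : K) * y ^ i = _
          ring
      _ = 0 := by rw [← Finset.mul_sum, hy, mul_zero]
  have := isIntegral_leadingCoeff_smul H y hHy
  rw [leadingCoeff, hHd, hH] at this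
  exact isIntegral_trans _ this

end OneVariable

section OneVariable

variable {O F K C : Type*} [CommRing O] [Field F] [Field K]
  [Algebra O F] [Algebra F K] [Algebra O K] [IsScalarTower O F K]
  [FiniteDimensional F K] [NormedField C] [IsAlgClosed C] [Algebra F C] [Algebra O C]
  [IsScalarTower O F C]

variable (O F C) in
theorem exists_finset_branch_approximation (f : K[X][X])
    (hsep : (f.map (evalRingHom 0)).Separable) (hlc : f.leadingCoeff.eval 0 ≠ 0)
    (c : K) (e : ℕ) :
    ∃ S : Finset C[X], (∀ Q ∈ S, Q.natDegree ≤ e) ∧ ∀ δ > 0, ∀ᶠ ν : C in cobounded C,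
      ∀ n : O, algebraMap O C n = ν → ∀ y : K, f.evalEval (algebraMap O K n)⁻¹ y = 0 →
        ∀ σ : K →ₐ[F] C, ∃ Q ∈ S, ‖σ (c * algebraMap O K n ^ e *
          f.leadingCoeff.eval (algebraMap O K n)⁻¹ * y) - Q.eval ν‖ < δ := by
  classical
  have hlcσ (σ : K →ₐ[F] C) : (f.map (mapRingHom (σ : K →+* C))).leadingCoeff =
      f.leadingCoeff.map (σ : K →+* C) :=
    leadingCoeff_map_of_injective (f := mapRingHom (σ : K →+* C))
      (map_injective _ (σ : K →+* C).injective) f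
  have hlc' (σ : K →ₐ[F] C) : (f.map (mapRingHom (σ : K →+* C))).leadingCoeff.eval 0 ≠ 0 := by
    rw [hlcσ, ← map_zero (σ : K →+* C), eval_map_apply]
    simpa using hlc
  have hsep' (σ : K →ₐ[F] C) :
      ((f.map (mapRingHom (σ : K →+* C))).map (evalRingHom 0)).Separable := by
    have : (f.map (mapRingHom (σ : K →+* C))).map (evalRingHom 0) =
        (f.map (evalRingHom 0)).map (σ : K →+* C) := by
      rw [Polynomial.map_map, Polynomial.map_map]
      congr 1
      ext <;> simp
    rw [this]
    exact hsep.map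
  have key (σ : K →ₐ[F] C) := exists_finset_polynomial_approximation
    (f.map (mapRingHom (σ : K →+* C))) (hsep' σ) (hlc' σ)
    (Polynomial.C (σ c) * f.leadingCoeff.map (σ : K →+* C)) e
  choose S hS h using key
  have := Fintype.ofFinite (K →ₐ[F] C)
  refine ⟨Finset.univ.biUnion S, fun Q hQ ↦ ?_, fun δ hδ ↦ ?_⟩
  · obtain ⟨σ, -, hσ⟩ := Finset.mem_biUnion.1 hQ
    exact hS σ Q hσ
  filter_upwards [eventually_all.2 fun σ ↦ h σ δ hδ] with ν hν n hn y hy σ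
  have hσn : σ (algebraMap O K n) = ν := by
    rw [IsScalarTower.algebraMap_apply O F K, σ.commutes, ← IsScalarTower.algebraMap_apply, hn]
  obtain ⟨Q, hQ, hQν⟩ := hν σ (σ y) (by
    rw [← hσn, ← map_inv₀]
    exact (map_mapRingHom_evalEval (σ : K →+* C) f _ _).trans (by rw [hy, map_zero]))
  refine ⟨Q, Finset.mem_biUnion.2 ⟨σ, Finset.mem_univ _, hQ⟩, ?_⟩
  convert hQν using 3
  have : (f.leadingCoeff.map (σ : K →+* C)).eval ν⁻¹ =
      σ (f.leadingCoeff.eval (algebraMap O K n)⁻¹) := by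
    rw [← hσn, ← map_inv₀]
    exact eval_map_apply (σ : K →+* C) _
  simp only [map_mul, map_pow, eval_mul, eval_C, this, hσn]
  ring

end OneVariable

section OneVariable

theorem exists_natDegree_coeff_le {R ι : Type*} [CommRing R] [Fintype ι] (f : ι → R[X][X]) :
    ∃ e, ∀ i j, ((f i).coeff j).natDegree ≤ e := by
  refine ⟨Finset.univ.sup fun i ↦ (f i).support.sup fun j ↦ ((f i).coeff j).natDegree,
    fun i j ↦ ?_⟩
  by_cases hj : j ∈ (f i).support
  · exact (Finset.le_sup (f := fun j ↦ ((f i).coeff j).natDegree) hj).trans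
      (Finset.le_sup (f := fun i ↦ (f i).support.sup fun j ↦ ((f i).coeff j).natDegree)
        (Finset.mem_univ i))
  · simp [notMem_support_iff.1 hj]

theorem tendsto_pow_add_cobounded {C : Type*} [NormedField C] {x : C} (hx : 1 < ‖x‖) (a : C) :
    Tendsto (fun N : ℕ ↦ x ^ N + a) atTop (cobounded C) := by
  rw [← tendsto_norm_atTop_iff_cobounded]
  refine tendsto_atTop_mono (fun N ↦ ?_)
    (tendsto_atTop_add_const_right _ (-‖a‖) (tendsto_pow_atTop_atTop_of_one_lt hx))
  rw [← norm_pow, ← norm_neg a]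
  simpa using norm_sub_le_norm_add (x ^ N) a

/-- A family of polynomials of degree at most `e` interpolating the values `w`. -/
theorem exists_polynomial_of_eq_sum_lagrange {K ι : Type*} [Field K] [DecidableEq ι]
    (s : Finset ι) (v w : ι → K) (hv : Function.Injective v) (a : K) :
    ∃ p : K[X], p.natDegree ≤ s.card - 1 ∧ ∀ l : ι,
      w l = ∑ i ∈ s, (Lagrange.basis s v i).eval (v l) * w i → p.eval (a + v l) = w l := by
  refine ⟨∑ i ∈ s, (Lagrange.basis s v i).comp (X - C a) * C (w i), ?_, fun l hl ↦ ?_⟩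
  · refine natDegree_sum_le_of_forall_le _ _ fun i hi ↦ natDegree_mul_le.trans ?_
    rw [natDegree_C, add_zero, natDegree_comp, natDegree_X_sub_C, mul_one]
    exact natDegree_le_of_degree_le (Lagrange.degree_basis hv.injOn hi).le
  · rw [hl]
    simp [eval_finsetSum]

theorem eval_scaleRoots_reflect_eq_zero {K : Type*} [Field K] {f : K[X][X]} {p : K[X]} {e : ℕ}
    (hp : p.natDegree ≤ e) {n c y : K} (hn : n ≠ 0) (hy : f.evalEval n⁻¹ y = 0)
    (h : p.eval n = c * n ^ e * f.leadingCoeff.eval n⁻¹ * y) :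
    ((f.scaleRoots (C c * f.leadingCoeff)).eval (p.reflect e)).eval n⁻¹ = 0 := by
  have h1 : (p.reflect e).eval n⁻¹ = (C c * f.leadingCoeff).eval n⁻¹ * y := by
    rw [eval_reflect hp (inv_ne_zero hn), inv_inv, h, eval_mul, eval_C, inv_pow]
    field_simp
  rw [eval_eval_eq_evalEval, h1, evalEval_scaleRoots_mul, hy, mul_zero]

theorem exists_forall_evalEval_ne_zero_of_zero {O : Type*} (F : Type*) {K C : Type*} [CommRing O]
    [IsDomain O] [IsIntegrallyClosed O] [Field F] [Field K] [Algebra O F] [IsFractionRing O F]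
    [Algebra F K] [Algebra O K] [IsScalarTower O F K] [FiniteDimensional F K] [NormedField C]
    [IsAlgClosed C] [Algebra F C] [Algebra O C] [IsScalarTower O F C]
    (hO : ∀ a : O, a ≠ 0 → 1 ≤ ‖algebraMap O C a‖) (x : O) (hx : 1 < ‖algebraMap O C x‖)
    {ι : Type*} [Fintype ι] (f : ι → K[X][X])
    (hsep : ∀ i, ((f i).map (evalRingHom 0)).Separable)
    (hlc : ∀ i, (f i).leadingCoeff.eval 0 ≠ 0) (hno : ∀ i, NoFractionRoot (f i))
    (G : K[X]) (hG : G ≠ 0) :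
    ∃ t, G.eval t ≠ 0 ∧ ∀ i y, (f i).evalEval t y ≠ 0 := by
  classical
  by_contra! hcon
  have hOC : Function.Injective (algebraMap O C) := by
    rw [IsScalarTower.algebraMap_eq O F C]
    exact (algebraMap F C).injective.comp (IsFractionRing.injective O F)
  have hOK : Function.Injective (algebraMap O K) := by
    rw [IsScalarTower.algebraMap_eq O F K]
    exact (algebraMap F K).injective.comp (IsFractionRing.injective O F)
  have hpow : Function.Injective fun N : ℕ ↦ x ^ N := by
    intro a b hab
    have := congrArg (fun z ↦ ‖algebraMap O C z‖) hab
    simp only [map_pow, norm_pow] at this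
    exact pow_right_injective₀ (zero_lt_one.trans hx) hx.ne' this
  obtain ⟨e, he⟩ := exists_natDegree_coeff_le f
  choose c hc0 hc using fun i ↦ exists_isIntegral_mul_of_root O F (f i) e (he i)
  choose S hS hSδ using fun i ↦
    exists_finset_branch_approximation O F C (f i) (hsep i) (hlc i) (c i) e
  have := Fintype.ofFinite (K →ₐ[F] C)
  set T := Finset.univ.biUnion S
  set L := e + ∑ i, e * ((f i).natDegree + 1)
  set m := Fintype.card (ι × ((K →ₐ[F] C) → T)) * L + 1
  let ε : Fin m → O := fun l ↦ x ^ (l : ℕ)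
  have hε : Function.Injective ε := hpow.comp Fin.val_injective
  obtain ⟨δ, hδ, hδ0⟩ := ((eventually_all.2 fun s : Finset (Fin m) ↦ eventually_all.2 fun l ↦
    eventually_eq_sum_lagrange (F := F) (K := K) (C := C) hO s ε hε l).and
    self_mem_nhdsWithin).exists
  have hδ0 : 0 < δ := hδ0
  have htend (l : Fin m) :
      Tendsto (fun N : ℕ ↦ algebraMap O C (x ^ N + ε l)) atTop (cobounded C) := by
    simpa using tendsto_pow_add_cobounded hx (algebraMap O C (ε l))
  have hGev (l : Fin m) : ∀ᶠ N : ℕ in atTop, G.eval (algebraMap O K (x ^ N + ε l))⁻¹ ≠ 0 := by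
    have hinj : Function.Injective fun N : ℕ ↦ (algebraMap O K (x ^ N + ε l))⁻¹ :=
      inv_injective.comp (hOK.comp ((add_left_injective (ε l)).comp hpow))
    have h1 := hinj.tendsto_cofinite
    rw [Nat.cofinite_eq_atTop] at h1
    exact h1.eventually (p := fun t ↦ G.eval t ≠ 0)
      (mem_of_superset G.roots.toFinset.finite_toSet.compl_mem_cofinite
        fun t ht h ↦ ht (by simpa [hG] using h))
  obtain ⟨N, hN⟩ := (eventually_all.2 fun l : Fin m ↦ ((htend l).eventually
    (eventually_all.2 fun i ↦ hSδ i δ hδ0)).and ((hGev l).and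
      ((htend l).eventually (eventually_ne_cobounded 0)))).exists
  let n : Fin m → O := fun l ↦ x ^ N + ε l
  have hn : Function.Injective n := (add_right_injective (x ^ N)).comp hε
  have hn0 (l : Fin m) : n l ≠ 0 := fun h ↦ (hN l).2.2 (by
    change algebraMap O C (n l) = 0
    rw [h, map_zero])
  choose i y hy using fun l ↦ hcon _ (hN l).2.1
  choose Q hQ hQδ using fun l ↦ (hN l).1 (i l) (n l) rfl (y l) (hy l)
  let col : Fin m → ι × ((K →ₐ[F] C) → T) := fun l ↦
    (i l, fun σ ↦ ⟨Q l σ, Finset.mem_biUnion.2 ⟨i l, Finset.mem_univ _, hQ l σ⟩⟩)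
  obtain ⟨⟨i₀, q⟩, hq⟩ := Fintype.exists_lt_card_fiber_of_mul_lt_card (n := L) col (by simp [m])
  set A := Finset.univ.filter fun l ↦ col l = (i₀, q) with hA
  have hAi {l : Fin m} (hl : l ∈ A) : i l = i₀ := congrArg Prod.fst (Finset.mem_filter.1 hl).2
  have hAQ {l : Fin m} (hl : l ∈ A) (σ) : Q l σ = q σ :=
    congrArg (fun z ↦ ((z.2 σ : T) : C[X])) (Finset.mem_filter.1 hl).2
  obtain ⟨s, hsA, hs⟩ := Finset.exists_subset_card_eq (show e + 1 ≤ A.card by omega)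
  let w : Fin m → K := fun l ↦ c (i l) * algebraMap O K (n l) ^ e *
    (f (i l)).leadingCoeff.eval (algebraMap O K (n l))⁻¹ * y l
  obtain ⟨p, hp, hpw⟩ := exists_polynomial_of_eq_sum_lagrange s (fun l ↦ algebraMap O K (ε l)) w
    (hOK.comp hε) (algebraMap O K (x ^ N))
  rw [hs, Nat.add_sub_cancel] at hp
  have hpn (l : Fin m) (hl : l ∈ A) : p.eval (algebraMap O K (n l)) = w l := by
    rw [map_add]
    refine hpw l (hδ s l (x ^ N) w (fun j _ ↦ hc _ _ (hn0 j) _ (hy j)) fun σ ↦ ?_)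
    refine ⟨q σ, ?_, fun j hj ↦ ?_⟩
    · obtain ⟨i', -, hi'⟩ := Finset.mem_biUnion.1 (q σ).2
      have := hS i' _ hi'
      omega
    · have hj : j ∈ A := Finset.insert_subset hl hsA hj
      rw [← hAQ hj]
      exact hQδ j σ
  have hΦ0 := hno i₀ (p.reflect e) (Polynomial.C (c i₀) * (f i₀).leadingCoeff)
    (mul_ne_zero (C_ne_zero.2 (hc0 i₀)) (leadingCoeff_ne_zero.2 (hno i₀).ne_zero))
  set Φ := ((f i₀).scaleRoots (Polynomial.C (c i₀) * (f i₀).leadingCoeff)).eval (p.reflect e)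
  have hΦ : Φ.natDegree ≤ L := by
    refine (natDegree_scaleRoots_eval_le _ _ _ e (he i₀)
      ((natDegree_C_mul_le _ _).trans (he i₀ _)) (natDegree_reflect_le.trans (by simp [hp]))).trans ?_
    exact (Finset.single_le_sum (f := fun i ↦ e * ((f i).natDegree + 1)) (fun _ _ ↦ Nat.zero_le _)
      (Finset.mem_univ i₀)).trans (Nat.le_add_left _ _)
  have hroots : (A.image fun l ↦ (algebraMap O K (n l))⁻¹).val ⊆ Φ.roots := by
    intro t ht
    obtain ⟨l, hl, rfl⟩ := Finset.mem_image.1 (Finset.mem_def.2 ht)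
    rw [mem_roots hΦ0]
    have hw := hpn l hl
    have hyl := hy l
    simp only [w] at hw
    rw [hAi hl] at hw hyl
    refine eval_scaleRoots_reflect_eq_zero hp ?_ hyl hw
    rw [Ne, map_eq_zero_iff _ hOK]
    exact hn0 l
  have hcard := card_le_degree_of_subset_roots hroots
  have := Finset.card_image_of_injective A (inv_injective.comp (hOK.comp hn))
  exact absurd (hq.trans_le (this.ge.trans hcard)) (not_lt.2 hΦ)

end OneVariable

section Specialization

theorem noFractionRoot_of_map {R K : Type*} [CommRing R] [Field K] {f : R[X]} (φ : R →+* K)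
    (hφ : Function.Injective φ) (hf : ∀ y, (f.map φ).eval y ≠ 0) : NoFractionRoot f := by
  intro p q hq h
  have hq : φ q ≠ 0 := by rwa [Ne, map_eq_zero_iff φ hφ]
  have h1 := scaleRoots_eval₂_mul (p := f) φ (φ p / φ q) q
  have h2 : eval₂ φ (φ p) (f.scaleRoots q) = 0 := by
    rw [eval₂_at_apply, h, map_zero]
  rw [mul_div_cancel₀ _ hq, h2, ← eval_map] at h1
  exact mul_ne_zero (pow_ne_zero _ hq) (hf _) h1.symm

theorem NoFractionRoot.map {R S : Type*} [CommRing R] [CommRing S] [IsDomain S] {f : R[X]}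
    (hf : NoFractionRoot f) (φ : R →+* S) (hφ : Function.Injective φ)
    (h : ∀ p q : S, ∃ c ≠ 0, ∃ p' q' : R, φ p' = c * p ∧ φ q' = c * q) :
    NoFractionRoot (f.map φ) := by
  intro p q hq h0
  obtain ⟨c, hc, p', q', hp, hq'⟩ := h p q
  refine hf p' q' ?_ (hφ ?_)
  · rintro rfl
    exact mul_ne_zero hc hq (by rw [← hq', map_zero])
  · have h1 : (f.map φ).scaleRoots (φ q') = (f.scaleRoots q').map φ := by
      ext i
      simp [natDegree_map_eq_of_injective hφ]
    rw [map_zero, ← eval_map_apply, ← h1, hp, hq', mul_comm c q, scaleRoots_mul,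
      scaleRoots_eval_mul, h0, mul_zero]

theorem NoFractionRoot.map_equiv {R S : Type*} [CommRing R] [CommRing S] [IsDomain S] {f : R[X]}
    (hf : NoFractionRoot f) (e : R ≃+* S) : NoFractionRoot (f.map (e : R →+* S)) :=
  hf.map _ e.injective fun p q ↦ ⟨1, one_ne_zero, e.symm p, e.symm q, by simp, by simp⟩

variable {R K : Type*} [CommRing R] [IsDomain R] [Field K] [Algebra R K] [IsFractionRing R K]

theorem exists_map_eq_C_mul (p q : K[X]) :
    ∃ c : R, c ≠ 0 ∧ ∃ p' q' : R[X], p'.map (algebraMap R K) = C (algebraMap R K c) * p ∧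
      q'.map (algebraMap R K) = C (algebraMap R K c) * q := by
  obtain ⟨b, hbM, hb⟩ := IsLocalization.integerNormalization_spec (nonZeroDivisors R) p
  obtain ⟨b', hbM', hb'⟩ := IsLocalization.integerNormalization_spec (nonZeroDivisors R) q
  refine ⟨b * b', mul_ne_zero (nonZeroDivisors.ne_zero hbM) (nonZeroDivisors.ne_zero hbM'),
    C b' * IsLocalization.integerNormalization (nonZeroDivisors R) p,
    C b * IsLocalization.integerNormalization (nonZeroDivisors R) q, ?_, ?_⟩
  · rw [Polynomial.map_mul, hb, map_C, Algebra.smul_def, Polynomial.algebraMap_apply, map_mul, C_mul]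
    ring
  · rw [Polynomial.map_mul, hb', map_C, Algebra.smul_def, Polynomial.algebraMap_apply, map_mul, C_mul]
    ring

theorem NoFractionRoot.map_mapRingHom {f : R[X][X]} (hf : NoFractionRoot f) :
    NoFractionRoot (f.map (mapRingHom (algebraMap R K))) := by
  refine hf.map _ (map_injective _ (IsFractionRing.injective R K)) fun p q ↦ ?_
  obtain ⟨c, hc, p', q', hp, hq⟩ := exists_map_eq_C_mul (R := R) p q
  exact ⟨C (algebraMap R K c), by simpa using hc, p', q', hp, hq⟩

theorem genericallySeparable_of_map {f : R[X]} (hf : (f.map (algebraMap R K)).Separable) :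
    GenericallySeparable f := by
  obtain ⟨a, b, h⟩ := hf
  obtain ⟨c, hc, a', b', ha, hb⟩ := exists_map_eq_C_mul (R := R) a b
  refine ⟨c, hc, a', b', map_injective _ (IsFractionRing.injective R K) ?_⟩
  rw [Polynomial.map_add, Polynomial.map_mul, Polynomial.map_mul, ha, hb, ← derivative_map, map_C]
  linear_combination C (algebraMap R K c) * h

theorem noFractionRoot_of_irreducible {R : Type*} [CommRing R] [IsDomain R]
    [UniqueFactorizationMonoid R] {f : R[X]} (hf : Irreducible f) (hd : 2 ≤ f.natDegree) :
    NoFractionRoot f := by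
  have hinj := IsFractionRing.injective R (FractionRing R)
  let := Classical.choice (inferInstance : Nonempty (NormalizedGCDMonoid R))
  have hirr := ((hf.isPrimitive (by omega)).irreducible_iff_irreducible_map_fraction_map
    (K := FractionRing R)).1 hf
  refine noFractionRoot_of_map _ hinj fun y hy ↦ ?_
  have : _ = 1 := natDegree_eq_of_degree_eq_some (degree_eq_one_of_irreducible_of_root hirr hy)
  rw [natDegree_map_eq_of_injective hinj] at this
  omega

theorem exists_homogeneous_eval {A : Type*} [CommRing A] (a b : A) (D : ℕ) :
    ∃ h : A[X] →ₗ[A] A, ∀ p : A[X], p.natDegree ≤ D → ∀ (L : Type) [Field L] (φ : A →+* L),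
      φ b ≠ 0 → φ (h p) = φ b ^ D * p.eval₂ φ (φ a / φ b) := by
  refine ⟨∑ i ∈ Finset.range (D + 1), (a ^ i * b ^ (D - i)) • lcoeff A i,
    fun p hp L _ φ hb ↦ ?_⟩
  rw [eval₂_eq_sum_range' φ (Nat.lt_succ_of_le hp), LinearMap.sum_apply, map_sum, Finset.mul_sum]
  refine Finset.sum_congr rfl fun i hi ↦ ?_
  have hi : i ≤ D := Nat.lt_succ_iff.1 (Finset.mem_range.1 hi)
  have : φ b ^ D = φ b ^ (D - i) * φ b ^ i := by rw [← pow_add, Nat.sub_add_cancel hi]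
  simp only [LinearMap.smul_apply, lcoeff_apply, smul_eq_mul, map_mul, map_pow, div_pow, this]
  field_simp

theorem exists_homogeneous_specialization {A : Type*} [CommRing A] (a b : A) (D : ℕ) (f : A[X][X])
    (hf : ∀ i, (f.coeff i).natDegree ≤ D) :
    ∃ g : A[X], ∀ (L : Type) [Field L] (φ : A →+* L), φ b ≠ 0 →
      g.map φ = C (φ b ^ D) * f.map (eval₂RingHom φ (φ a / φ b)) := by
  obtain ⟨h, hh⟩ := exists_homogeneous_eval a b D
  refine ⟨∑ i ∈ Finset.range (f.natDegree + 1), monomial i (h (f.coeff i)),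
    fun L _ φ hb ↦ ?_⟩
  ext j
  rw [coeff_map, coeff_C_mul, coeff_map, coe_eval₂RingHom, ← hh _ (hf j) L φ hb, finsetSum_coeff]
  congr 1
  simp only [coeff_monomial, Finset.sum_ite_eq', Finset.mem_range]
  split_ifs with hj
  · rfl
  · rw [coeff_eq_zero_of_natDegree_lt (by omega), map_zero]

end Specialization

section Hilbert

/-- Hilbert's property for one-parameter families of polynomials over `K`. -/
def OneVariableHilbert (K : Type) [Field K] : Prop :=
  ∀ (ι : Type) [Fintype ι] (f : ι → K[X][X]), (∀ i, GenericallySeparable (f i)) →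
    (∀ i, NoFractionRoot (f i)) → ∀ G : K[X], G ≠ 0 →
      ∃ t, G.eval t ≠ 0 ∧ ∀ i y, (f i).evalEval t y ≠ 0

/-- Hilbert's property for `m`-parameter families of polynomials over `k`. -/
def MultivariateHilbert (k : Type) [Field k] (m : ℕ) : Prop :=
  ∀ (ι : Type) [Fintype ι] (f : ι → (MvPolynomial (Fin m) k)[X]),
    (∀ i, GenericallySeparable (f i)) → (∀ i, NoFractionRoot (f i)) →
      ∀ G : MvPolynomial (Fin m) k, G ≠ 0 →
        ∃ t, MvPolynomial.eval t G ≠ 0 ∧ ∀ i y, ((f i).map (MvPolynomial.eval t)).eval y ≠ 0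

theorem oneVariableHilbert_of_norm {O F K C : Type} [CommRing O]
    [IsDomain O] [IsIntegrallyClosed O] [Field F] [Field K] [Algebra O F] [IsFractionRing O F]
    [Algebra F K] [Algebra O K] [IsScalarTower O F K] [FiniteDimensional F K] [NormedField C]
    [IsAlgClosed C] [Algebra F C] [Algebra O C] [IsScalarTower O F C]
    (hO : ∀ a : O, a ≠ 0 → 1 ≤ ‖algebraMap O C a‖) (x : O) (hx : 1 < ‖algebraMap O C x‖) :
    OneVariableHilbert K := by
  intro ι _ f hsep hno G hG
  have hinf : Infinite K := by
    have hOK : Function.Injective (algebraMap O K) := by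
      rw [IsScalarTower.algebraMap_eq O F K]
      exact (algebraMap F K).injective.comp (IsFractionRing.injective O F)
    refine Infinite.of_injective (fun N : ℕ ↦ algebraMap O K (x ^ N)) (hOK.comp fun a b hab ↦ ?_)
    have := congrArg (fun z ↦ ‖algebraMap O C z‖) hab
    simp only [map_pow, norm_pow] at this
    exact pow_right_injective₀ (zero_lt_one.trans hx) hx.ne' this
  choose d hd0 a b hab using hsep
  have hprod : ∏ i, (d i * (f i).leadingCoeff) ≠ 0 := Finset.prod_ne_zero_iff.2 fun i _ ↦
    mul_ne_zero (hd0 i) (leadingCoeff_ne_zero.2 (hno i).ne_zero)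
  obtain ⟨t₀, ht₀⟩ : ∃ t₀, (∏ i, (d i * (f i).leadingCoeff)).eval t₀ ≠ 0 := by
    by_contra! h
    exact hprod (Polynomial.funext fun t ↦ by rw [h, eval_zero])
  have ht₀ (i : ι) : (d i).eval t₀ ≠ 0 ∧ (f i).leadingCoeff.eval t₀ ≠ 0 := by
    rw [eval_prod, Finset.prod_ne_zero_iff] at ht₀
    have := ht₀ i (Finset.mem_univ i)
    rw [eval_mul] at this
    exact ⟨left_ne_zero_of_mul this, right_ne_zero_of_mul this⟩
  let τ : K[X] ≃+* K[X] := (algEquivAevalXAddC t₀ : K[X] ≃ₐ[K] K[X]).toRingEquiv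
  have hτ (p : K[X]) (t : K) : (τ p).eval t = p.eval (t + t₀) := by
    change (aeval (X + Polynomial.C t₀) p).eval t = _
    rw [← coe_aeval_eq_eval, ← aeval_algHom_apply]
    simp
  have hτ' (t : K) : (evalRingHom t).comp (τ : K[X] →+* K[X]) = evalRingHom (t + t₀) :=
    RingHom.ext fun p ↦ hτ p t
  have hsep₀ (i : ι) : (((f i).map (τ : K[X] →+* K[X])).map (evalRingHom 0)).Separable := by
    rw [Polynomial.map_map, hτ', zero_add]
    exact separable_map_of_bezout (hab i) (evalRingHom t₀) (ht₀ i).1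
  have hlc₀ (i : ι) : ((f i).map (τ : K[X] →+* K[X])).leadingCoeff.eval 0 ≠ 0 := by
    rw [leadingCoeff_map_of_injective (f := (τ : K[X] →+* K[X])) τ.injective]
    change (τ _).eval 0 ≠ 0
    rw [hτ, zero_add]
    exact (ht₀ i).2
  obtain ⟨t, ht, htf⟩ := exists_forall_evalEval_ne_zero_of_zero F hO x hx _ hsep₀ hlc₀
    (fun i ↦ (hno i).map_equiv τ) (τ G) (by simpa using hG)
  refine ⟨t + t₀, hτ G t ▸ ht, fun i y h ↦ htf i y ?_⟩
  rwa [← map_evalRingHom_eval, Polynomial.map_map, hτ', map_evalRingHom_eval]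

theorem multivariateHilbert_zero (k : Type) [Field k] : MultivariateHilbert k 0 := by
  intro ι _ f _ hno G hG
  let e : MvPolynomial (Fin 0) k ≃+* k := (MvPolynomial.isEmptyAlgEquiv k (Fin 0)).toRingEquiv
  have he : MvPolynomial.eval (Fin.elim0 : Fin 0 → k) = (e : MvPolynomial (Fin 0) k →+* k) :=
    MvPolynomial.ringHom_ext
      (fun r ↦ (MvPolynomial.eval_C r).trans ((MvPolynomial.isEmptyAlgEquiv k (Fin 0)).commutes r).symm)
      (fun i ↦ i.elim0)
  refine ⟨Fin.elim0, ?_, fun i y ↦ ?_⟩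
  · rw [he]
    simpa using hG
  · rw [he]
    simpa using (hno i).map_equiv e y 1 one_ne_zero

theorem multivariateHilbert_succ {k : Type} [Field k] {m : ℕ}
    (h1 : OneVariableHilbert (FractionRing (MvPolynomial (Fin m) k)))
    (hm : MultivariateHilbert k m) : MultivariateHilbert k (m + 1) := by
  intro ι _ f hsep hno G hG
  let A := MvPolynomial (Fin m) k
  let K := FractionRing A
  have hinj : Function.Injective (algebraMap A K) := IsFractionRing.injective A K
  have hinj' : Function.Injective (mapRingHom (algebraMap A K)) := map_injective _ hinj
  let τ : MvPolynomial (Fin (m + 1)) k ≃+* A[X] := (MvPolynomial.finSuccEquiv k m).toRingEquiv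
  let f' (i : ι) : A[X][X] := (f i).map (τ : _ →+* A[X])
  let G' : A[X] := τ G
  have hsep' (i : ι) : GenericallySeparable ((f' i).map (mapRingHom (algebraMap A K))) :=
    ((hsep i).map _ τ.injective).map _ hinj'
  have hno' (i : ι) : NoFractionRoot ((f' i).map (mapRingHom (algebraMap A K))) :=
    ((hno i).map_equiv τ).map_mapRingHom
  have hG' : G'.map (algebraMap A K) ≠ 0 := by
    rw [Ne, Polynomial.map_eq_zero_iff hinj]
    simpa [G'] using hG
  have hsep'' := hsep'
  choose d hd0 p q hpq using hsep''
  obtain ⟨t₀, ht₀, htf⟩ := h1 ι _ hsep' hno' (G'.map (algebraMap A K) * ∏ i, d i)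
    (mul_ne_zero hG' (Finset.prod_ne_zero_iff.2 fun i _ ↦ hd0 i))
  rw [eval_mul, eval_prod] at ht₀
  have hd (i : ι) : (d i).eval t₀ ≠ 0 :=
    Finset.prod_ne_zero_iff.1 (right_ne_zero_of_mul ht₀) i (Finset.mem_univ i)
  have hGt := left_ne_zero_of_mul ht₀
  obtain ⟨a, b, hb, rfl⟩ := IsFractionRing.div_surjective (A := A) t₀
  have hb0 : algebraMap A K b ≠ 0 := by
    simpa using nonZeroDivisors.ne_zero hb
  obtain ⟨D, hD⟩ := exists_natDegree_coeff_le f'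
  choose g hg using fun i ↦ exists_homogeneous_specialization a b D (f' i) (hD i)
  obtain ⟨h, hh⟩ := exists_homogeneous_eval a b G'.natDegree
  have hcomp : eval₂RingHom (algebraMap A K) (algebraMap A K a / algebraMap A K b) =
      (evalRingHom (algebraMap A K a / algebraMap A K b)).comp (mapRingHom (algebraMap A K)) := by
    ext <;> simp
  have hgK (i : ι) := hg i K (algebraMap A K) hb0
  simp only [hcomp, ← Polynomial.map_map] at hgK
  have hgsep (i : ι) : GenericallySeparable (g i) := by
    refine genericallySeparable_of_map (K := K) ?_
    rw [hgK]
    exact (separable_map_of_bezout (hpq i) _ (hd i)).unit_mul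
      (isUnit_C.2 (pow_ne_zero _ hb0).isUnit)
  have hgno (i : ι) : NoFractionRoot (g i) := by
    refine noFractionRoot_of_map (algebraMap A K) hinj fun y ↦ ?_
    rw [hgK, eval_mul, eval_C, map_evalRingHom_eval]
    exact mul_ne_zero (pow_ne_zero _ hb0) (htf i y)
  have hbG : b * h G' ≠ 0 := by
    refine mul_ne_zero (nonZeroDivisors.ne_zero hb) fun h0 ↦ ?_
    have := hh G' le_rfl K (algebraMap A K) hb0
    rw [h0, map_zero, ← eval_map] at this
    exact mul_ne_zero (pow_ne_zero _ hb0) hGt this.symm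
  obtain ⟨t, ht, htg⟩ := hm ι g hgsep hgno _ hbG
  rw [map_mul] at ht
  have htb := left_ne_zero_of_mul ht
  have htG := right_ne_zero_of_mul ht
  rw [hh G' le_rfl k _ htb] at htG
  have hτ : MvPolynomial.eval (Fin.cons (MvPolynomial.eval t a / MvPolynomial.eval t b) t) =
      (eval₂RingHom (MvPolynomial.eval t) (MvPolynomial.eval t a / MvPolynomial.eval t b)).comp
        (τ : MvPolynomial (Fin (m + 1)) k →+* A[X]) := by
    refine RingHom.ext fun p ↦ ?_
    rw [MvPolynomial.eval_eq_eval_mv_eval', eval_map]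
    rfl
  refine ⟨Fin.cons (MvPolynomial.eval t a / MvPolynomial.eval t b) t, ?_, fun i y hy ↦ ?_⟩
  · rw [hτ]
    exact right_ne_zero_of_mul htG
  · refine htg i y ?_
    rw [hτ, ← Polynomial.map_map] at hy
    rw [hg i k _ htb, eval_mul, hy, mul_zero]

end Hilbert

section FinitelyGenerated

theorem isAlgebraic_of_subfield_le {F k : Type*} [Field F] [Field k] [Algebra F k] {k₁ : Subfield k}
    (h : k₁ ≤ (algebraMap F k).fieldRange) [Algebra.IsAlgebraic k₁ k] :
    Algebra.IsAlgebraic F k := by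
  have h' (z : k₁) : ∃ y, algebraMap F k y = z := h z.2
  choose g hg using h'
  have hinj := (algebraMap F k).injective
  let φ : k₁ →+* F :=
    { toFun := g
      map_one' := hinj (by simp [hg])
      map_zero' := hinj (by simp [hg])
      map_mul' := fun a b ↦ hinj (by simp [hg])
      map_add' := fun a b ↦ hinj (by simp [hg]) }
  let := φ.toAlgebra
  have : IsScalarTower k₁ F k := IsScalarTower.of_algebraMap_eq fun z ↦ (hg z).symm
  exact Algebra.IsAlgebraic.tower_top (K := k₁) F

theorem finiteDimensional_of_closure_eq_top {F k : Type*} [Field F] [Field k] [Algebra F k]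
    [Algebra.IsAlgebraic F k] {s : Finset k} (hs : Subfield.closure (s : Set k) = ⊤) :
    FiniteDimensional F k := by
  have h1 : IntermediateField.adjoin F (s : Set k) = ⊤ := by
    refine top_le_iff.1 fun z _ ↦ ?_
    have h2 : Subfield.closure (s : Set k) ≤ (IntermediateField.adjoin F (s : Set k)).toSubfield :=
      Subfield.closure_le.2 (IntermediateField.subset_adjoin F _)
    exact h2 (hs ▸ Subfield.mem_top z)
  have h3 : FiniteDimensional F (IntermediateField.adjoin F (s : Set k)) :=
    IntermediateField.finiteDimensional_adjoin fun x _ ↦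
      (Algebra.IsAlgebraic.isAlgebraic (R := F) x).isIntegral
  rw [h1] at h3
  exact IntermediateField.topEquiv.toLinearEquiv.finiteDimensional

theorem oneVariableHilbert_of_charZero {k : Type} [Field k] [CharZero k]
    [FiniteDimensional ℚ k] : OneVariableHilbert k := by
  refine oneVariableHilbert_of_norm (O := ℤ) (F := ℚ) (C := ℂ) (fun a ha ↦ ?_) 2 (by simp)
  rw [eq_intCast, Complex.norm_intCast]
  exact_mod_cast Int.one_le_abs ha

theorem oneVariableHilbert_of_transcendental {k₀ k : Type} [Field k₀] [Field k] [Algebra k₀ k]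
    {a : k} (ha : Transcendental k₀ a)
    (hfin : ∀ (F : Type) [Field F] [Algebra F k],
      (∀ z : k₀, algebraMap k₀ k z ∈ (algebraMap F k).fieldRange) →
        a ∈ (algebraMap F k).fieldRange → FiniteDimensional F k) :
    OneVariableHilbert k := by
  obtain ⟨C, _, _, i, hi, hX⟩ := exists_isAlgClosed_normedField_of_ratFunc k₀
  let : Algebra k₀[X] k := (aeval a).toRingHom.toAlgebra
  have hinj : Function.Injective (algebraMap k₀[X] k) := transcendental_iff_injective.1 ha
  let : Algebra (RatFunc k₀) k := (IsFractionRing.lift (K := RatFunc k₀) hinj).toAlgebra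
  have : IsScalarTower k₀[X] (RatFunc k₀) k :=
    IsScalarTower.of_algebraMap_eq fun p ↦ (IsFractionRing.lift_algebraMap hinj p).symm
  let : Algebra (RatFunc k₀) C := i.toAlgebra
  let : Algebra k₀[X] C := (i.comp (algebraMap k₀[X] (RatFunc k₀))).toAlgebra
  have : IsScalarTower k₀[X] (RatFunc k₀) C := IsScalarTower.of_algebraMap_eq fun p ↦ rfl
  have hmem (p : k₀[X]) : aeval a p ∈ (algebraMap (RatFunc k₀) k).fieldRange :=
    ⟨algebraMap k₀[X] (RatFunc k₀) p, IsFractionRing.lift_algebraMap hinj p⟩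
  have : FiniteDimensional (RatFunc k₀) k :=
    hfin _ (fun z ↦ by simpa using hmem (Polynomial.C z)) (by simpa using hmem X)
  exact oneVariableHilbert_of_norm (O := k₀[X]) (F := RatFunc k₀) (C := C) hi X hX

theorem oneVariableHilbert_of_fg (k : Type) [Field k]
    (hfg : ∃ s : Finset k, Subfield.closure (s : Set k) = ⊤)
    (hk : ∀ (p : ℕ) [Fact p.Prime], IsEmpty (k →+* AlgebraicClosure (ZMod p))) :
    OneVariableHilbert k := by
  classical
  obtain ⟨s, hs⟩ := hfg
  by_cases h0 : Algebra.IsAlgebraic (Subfield.closure (∅ : Set k)) k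
  · obtain ⟨p, hp⟩ := CharP.exists k
    rcases CharP.char_is_prime_or_zero k p with hp' | rfl
    · have := Fact.mk hp'
      let := ZMod.algebra k p
      have := isAlgebraic_of_subfield_le (F := ZMod p) (k := k)
        (Subfield.closure_le.2 (Set.empty_subset _))
      exact ((hk p).false
        (IsAlgClosed.lift : k →ₐ[ZMod p] AlgebraicClosure (ZMod p)).toRingHom).elim
    · have : CharZero k := CharP.charP_to_charZero k
      have := isAlgebraic_of_subfield_le (F := ℚ) (k := k)
        (Subfield.closure_le.2 (Set.empty_subset _))
      have : FiniteDimensional ℚ k := finiteDimensional_of_closure_eq_top hs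
      exact oneVariableHilbert_of_charZero
  · let A := s.powerset.filter fun U : Finset k ↦
      ¬ Algebra.IsAlgebraic (Subfield.closure (U : Set k)) k
    have hA : A.Nonempty :=
      ⟨∅, Finset.mem_filter.2 ⟨Finset.empty_mem_powerset s, by rwa [Finset.coe_empty]⟩⟩
    obtain ⟨U, hU⟩ := A.exists_maximal hA
    obtain ⟨hUs, hUa⟩ : U ⊆ s ∧ ¬ Algebra.IsAlgebraic (Subfield.closure (U : Set k)) k := by
      simpa [A] using hU.prop
    obtain ⟨a, has, haU⟩ : ∃ a ∈ s, a ∉ U := by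
      by_contra! h
      rw [hUs.antisymm h, hs] at hUa
      refine hUa ⟨fun z ↦ ?_⟩
      exact isAlgebraic_algebraMap (A := k) (⟨z, Subfield.mem_top z⟩ : (⊤ : Subfield k))
    have haa : Algebra.IsAlgebraic (Subfield.closure ((insert a U : Finset k) : Set k)) k := by
      by_contra h
      have : insert a U ∈ A := by
        simp only [A, Finset.mem_filter, Finset.mem_powerset]
        exact ⟨Finset.insert_subset has hUs, h⟩
      exact haU (hU.le_of_ge this (Finset.subset_insert a U) (Finset.mem_insert_self a U))
    have key (F : Type) [Field F] [Algebra F k]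
        (h1 : ∀ z : Subfield.closure (U : Set k),
          algebraMap (Subfield.closure (U : Set k)) k z ∈ (algebraMap F k).fieldRange)
        (h2 : a ∈ (algebraMap F k).fieldRange) : Algebra.IsAlgebraic F k := by
      refine isAlgebraic_of_subfield_le
        (k₁ := Subfield.closure ((insert a U : Finset k) : Set k)) (Subfield.closure_le.2 ?_)
      rw [Finset.coe_insert]
      exact Set.insert_subset h2 fun z hz ↦ h1 ⟨z, Subfield.subset_closure hz⟩
    refine oneVariableHilbert_of_transcendental (k₀ := Subfield.closure (U : Set k)) (a := a)
      (fun hal ↦ hUa ?_) fun F _ _ h1 h2 ↦ ?_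
    · have := key (IntermediateField.adjoin (Subfield.closure (U : Set k)) {a})
        (fun z ↦ ⟨⟨_, IntermediateField.algebraMap_mem _ z⟩, rfl⟩)
        ⟨⟨a, IntermediateField.mem_adjoin_simple_self _ a⟩, rfl⟩
      have := IntermediateField.isAlgebraic_adjoin_simple hal.isIntegral
      exact Algebra.IsAlgebraic.trans _
        (IntermediateField.adjoin (Subfield.closure (U : Set k)) {a}) _
    · have := key F h1 h2
      exact finiteDimensional_of_closure_eq_top hs

theorem exists_subfield_closure_eq_top_fractionRing {k σ : Type*} [Field k] [Finite σ]
    (hfg : ∃ s : Finset k, Subfield.closure (s : Set k) = ⊤) :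
    ∃ s : Finset (FractionRing (MvPolynomial σ k)),
      Subfield.closure (s : Set (FractionRing (MvPolynomial σ k))) = ⊤ := by
  classical
  cases nonempty_fintype σ
  obtain ⟨s, hs⟩ := hfg
  set K := FractionRing (MvPolynomial σ k)
  let j := algebraMap (MvPolynomial σ k) K
  let T : Finset K := s.image (j.comp MvPolynomial.C) ∪ Finset.univ.image fun i ↦ j (.X i)
  refine ⟨T, top_le_iff.1 fun z _ ↦ ?_⟩
  have hC (c : k) : j (.C c) ∈ Subfield.closure (T : Set K) := by
    have : Subfield.closure (s : Set k) ≤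
        (Subfield.closure (T : Set K)).comap (j.comp MvPolynomial.C) :=
      Subfield.closure_le.2 fun c hc ↦ Subfield.subset_closure <| by
        simp only [T, Finset.coe_union, Finset.coe_image]
        exact Or.inl ⟨c, hc, rfl⟩
    exact this (hs ▸ Subfield.mem_top c)
  have hp (p : MvPolynomial σ k) : j p ∈ Subfield.closure (T : Set K) := by
    induction p using MvPolynomial.induction_on with
    | C c => exact hC c
    | add p q hp hq => rw [map_add]; exact add_mem hp hq
    | mul_X p i hp =>
      rw [map_mul]
      refine mul_mem hp (Subfield.subset_closure ?_)
      simp [T]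
  obtain ⟨p, q, _, rfl⟩ := IsFractionRing.div_surjective (A := MvPolynomial σ k) z
  exact div_mem (hp p) (hp q)

theorem multivariateHilbert_of_fg (k : Type) [Field k]
    (hfg : ∃ s : Finset k, Subfield.closure (s : Set k) = ⊤)
    (hk : ∀ (p : ℕ) [Fact p.Prime], IsEmpty (k →+* AlgebraicClosure (ZMod p))) (m : ℕ) :
    MultivariateHilbert k m := by
  induction m with
  | zero => exact multivariateHilbert_zero k
  | succ m hm =>
    refine multivariateHilbert_succ (oneVariableHilbert_of_fg _
      (exists_subfield_closure_eq_top_fractionRing hfg) fun p _ ↦ ⟨fun φ ↦ (hk p).false ?_⟩) hm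
    exact φ.comp ((algebraMap (MvPolynomial (Fin m) k) _).comp MvPolynomial.C)

end FinitelyGenerated

/-!
STATEMENT 13: Let `k` be a finitely generated field not contained in the algebraic closure
of a finite field, and `m ≥ 1`.  Then `ℙ^m(k)` is not thin; equivalently (passing to a
standard affine chart), `𝔸^m(k) = k^m` is not covered by finitely many thin sets of
type 1 (points of proper closed subvarieties) and type 2 (images of `k`-points under
separable, generically finite covers of degree ≥ 2).

Model: `k` is finitely generated (`hfg`: generated as a field by a finite set) and admits
no embedding into any `AlgebraicClosure (ZMod p)` (`hk`: this says exactly that `k` is not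
contained in the algebraic closure of a finite field).  A type-1 set is the zero locus of a
nonzero polynomial `g ∈ k[T₁,…,T_m]`.  A type-2 cover is given (birationally) by an
irreducible polynomial `f ∈ k[T₁,…,T_m][Y]` of degree ≥ 2 in `Y`, separable over the
function field `k(T₁,…,T_m)`; its thin set is `{t ∈ k^m : f(t, Y) has a root in k}`.
Conclusion (Hilbert irreducibility à la Serre/Fried–Jarden): there is a point `t ∈ k^m`
avoiding all the given type-1 sets and all the given type-2 sets.
-/
theorem stmt_13 (k : Type) [Field k]
    (hfg : ∃ s : Finset k, Subfield.closure (s : Set k) = ⊤)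
    (hk : ∀ (p : ℕ) [Fact p.Prime], IsEmpty (k →+* AlgebraicClosure (ZMod p)))
    (m : ℕ) (hm : 1 ≤ m)
    (T1 : Finset (MvPolynomial (Fin m) k)) (hT1 : ∀ g ∈ T1, g ≠ 0)
    (ι : Type) [Fintype ι]
    (f : ι → Polynomial (MvPolynomial (Fin m) k))
    (hfirr : ∀ i, Irreducible (f i))
    (hfdeg : ∀ i, 2 ≤ (f i).natDegree)
    (hfsep : ∀ i, ((f i).map (algebraMap (MvPolynomial (Fin m) k)
      (FractionRing (MvPolynomial (Fin m) k)))).Separable) :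
    ∃ t : Fin m → k,
      (∀ g ∈ T1, MvPolynomial.eval t g ≠ 0) ∧
      (∀ i, ¬ ∃ y : k, Polynomial.eval y ((f i).map (MvPolynomial.eval t)) = 0) := by
  obtain ⟨t, ht, hty⟩ := multivariateHilbert_of_fg k hfg hk m ι f
    (fun i ↦ genericallySeparable_of_map (hfsep i))
    (fun i ↦ noFractionRoot_of_irreducible (hfirr i) (hfdeg i))
    (∏ g ∈ T1, g) (Finset.prod_ne_zero_iff.2 hT1)
  rw [map_prod, Finset.prod_ne_zero_iff] at ht
  exact ⟨t, ht, fun i ⟨y, hy⟩ ↦ hty i y hy⟩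
end
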